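/- For every p ∈ (1, ∞) there is a constant C(p) > 0 such that for every continuously differentiable, compactly supported function ω : ℝ² → ℝ, the gradient of the Biot–Savart velocity satisfies ‖∇𝕌(ω)‖_{L^p(ℝ²)} ≤ C(p) ( ‖ω‖_{L¹} + ‖ω‖_{L∞} ). -/

import Mathlib

open MeasureTheory ENNReal

noncomputable section

/-- The perpendicular rotation `(z₁, z₂)^⊥ = (−z₂, z₁)` in the plane. -/
def perp (z : EuclideanSpace ℝ (Fin 2)) : EuclideanSpace ℝ (Fin 2) :=
  (WithLp.equiv 2 (Fin 2 → ℝ)).symm ![-(z 1), z 0]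

/-- The Biot–Savart velocity `𝕌(ω)(x) = (1/2π) ∫ ((x−y)^⊥/|x−y|²) ω(y) dy`. -/
def biotSavart (ω : EuclideanSpace ℝ (Fin 2) → ℝ) (x : EuclideanSpace ℝ (Fin 2)) :
    EuclideanSpace ℝ (Fin 2) :=
  (1 / (2 * Real.pi)) • ∫ y, (ω y / ‖x - y‖ ^ 2) • perp (x - y)

section

open Set Filter Topology
open scoped RealInnerProductSpace

theorem exists_lintegral_rpow_le_of_weak_type {α q β : ℝ} (hα : 0 < α) (hαq : α < q)
    (hqβ : q < β) :
    ∃ C : NNReal, ∀ {X : Type} [MeasurableSpace X] (μ : Measure X) (F : X → ℝ) (a : ℝ≥0∞),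
      AEMeasurable F μ →
      (∀ t : ℝ, 0 < t → μ {x | t < |F x|} ≤ a * ENNReal.ofReal (t ^ (-α))) →
      (∀ t : ℝ, 0 < t → μ {x | t < |F x|} ≤ a * ENNReal.ofReal (t ^ (-β))) →
      ∫⁻ x, ENNReal.ofReal (|F x| ^ q) ∂μ ≤ C * a := by
  have h1 : ∫⁻ t in Ioc (0 : ℝ) 1, ENNReal.ofReal (t ^ (q - 1 - α)) < ⊤ := by
    have := (intervalIntegral.intervalIntegrable_rpow' (a := 0) (b := 1)
      (r := q - 1 - α) (by linarith)).1
    exact this.lintegral_lt_top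
  have h2 : ∫⁻ t in Ioi (1 : ℝ), ENNReal.ofReal (t ^ (q - 1 - β)) < ⊤ :=
    (integrableOn_Ioi_rpow_of_lt (a := q - 1 - β) (by linarith) one_pos).lintegral_lt_top
  set I := ∫⁻ t in Ioc (0 : ℝ) 1, ENNReal.ofReal (t ^ (q - 1 - α))
  set J := ∫⁻ t in Ioi (1 : ℝ), ENNReal.ofReal (t ^ (q - 1 - β))
  have hC : ENNReal.ofReal q * (I + J) ≠ ⊤ :=
    ENNReal.mul_ne_top ENNReal.ofReal_ne_top (ENNReal.add_ne_top.2 ⟨h1.ne, h2.ne⟩)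
  refine ⟨(ENNReal.ofReal q * (I + J)).toNNReal, fun {X} _ μ F a hF hw1 hw2 => ?_⟩
  rw [ENNReal.coe_toNNReal hC, lintegral_rpow_eq_lintegral_meas_lt_mul μ
    (Eventually.of_forall fun x => abs_nonneg _) hF.abs (by linarith), mul_assoc]
  gcongr
  have key : ∀ γ : ℝ, ∀ t : ℝ, 0 < t → ENNReal.ofReal (t ^ (-γ)) * ENNReal.ofReal (t ^ (q - 1))
      = ENNReal.ofReal (t ^ (q - 1 - γ)) := by
    intro γ t ht
    rw [← ENNReal.ofReal_mul (by positivity), ← Real.rpow_add ht]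
    ring_nf
  rw [← Ioc_union_Ioi_eq_Ioi (zero_le_one (α := ℝ)), lintegral_union measurableSet_Ioi
    (Set.Ioc_disjoint_Ioi le_rfl), add_mul]
  have meas : ∀ γ : ℝ, Measurable fun t : ℝ => ENNReal.ofReal (t ^ (q - 1 - γ)) :=
    fun γ => by fun_prop
  refine add_le_add ?_ ?_
  · rw [mul_comm I, ← lintegral_const_mul _ (meas α)]
    refine setLIntegral_mono ((meas α).const_mul _) fun t ht => ?_
    rw [← key α t ht.1, ← mul_assoc]
    gcongr
    exact hw1 t ht.1
  · rw [mul_comm J, ← lintegral_const_mul _ (meas β)]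
    refine setLIntegral_mono ((meas β).const_mul _) fun t ht => ?_
    have htt : 0 < t := lt_trans one_pos ht
    rw [← key β t htt, ← mul_assoc]
    gcongr
    exact hw2 t htt

/-- The Euclidean plane. -/
abbrev Plane := EuclideanSpace ℝ (Fin 2)

/-- The index of the dyadic square of side `s / 2 ^ m` containing `x`. -/
def dyadicIndex (s : ℝ) (m : ℕ) (x : Plane) : Fin 2 → ℤ :=
  fun i => ⌊x i / (s / 2 ^ m)⌋

/-- The half-open dyadic square of side `s / 2 ^ m` with index `k`. -/
def dyadicSquare (s : ℝ) (m : ℕ) (k : Fin 2 → ℤ) : Set Plane :=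
  {x | dyadicIndex s m x = k}

theorem dyadicIndex_eq_of_succ {s : ℝ} {m : ℕ} {x y : Plane}
    (h : dyadicIndex s (m + 1) x = dyadicIndex s (m + 1) y) :
    dyadicIndex s m x = dyadicIndex s m y := by
  have key : ∀ z : Plane, ∀ i, dyadicIndex s m z i = dyadicIndex s (m + 1) z i / (2 : ℕ) := by
    intro z i
    simp only [dyadicIndex]
    rw [← Int.floor_div_natCast]
    congr 1
    rcases eq_or_ne s 0 with rfl | hs
    · simp
    · field_simp
      push_cast
      ring
  ext i
  rw [key x, key y, h]

theorem dyadicIndex_eq_of_le {s : ℝ} {m n : ℕ} (hmn : m ≤ n) {x y : Plane}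
    (h : dyadicIndex s n x = dyadicIndex s n y) :
    dyadicIndex s m x = dyadicIndex s m y := by
  induction n, hmn using Nat.le_induction with
  | base => exact h
  | succ n _ ih => exact ih (dyadicIndex_eq_of_succ h)

theorem dyadicSquare_eq_preimage {s : ℝ} (hs : 0 < s) (m : ℕ) (k : Fin 2 → ℤ) :
    dyadicSquare s m k = WithLp.ofLp ⁻¹'
      (univ.pi fun i => Ico ((k i : ℝ) * (s / 2 ^ m)) ((k i : ℝ) * (s / 2 ^ m) + s / 2 ^ m)) := by
  have hl : 0 < s / 2 ^ m := by positivity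
  ext x
  simp only [dyadicSquare, dyadicIndex, mem_ofPred_eq, funext_iff, Int.floor_eq_iff, mem_preimage,
    mem_univ_pi, mem_Ico, le_div_iff₀ hl, div_lt_iff₀ hl, add_mul, one_mul]

theorem measurableSet_dyadicSquare {s : ℝ} (hs : 0 < s) (m : ℕ) (k : Fin 2 → ℤ) :
    MeasurableSet (dyadicSquare s m k) := by
  rw [dyadicSquare_eq_preimage hs]
  exact (PiLp.volume_preserving_ofLp (Fin 2)).measurable
    (MeasurableSet.univ_pi fun i => measurableSet_Ico)

theorem volume_dyadicSquare {s : ℝ} (hs : 0 < s) (m : ℕ) (k : Fin 2 → ℤ) :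
    volume (dyadicSquare s m k) = ENNReal.ofReal (s / 2 ^ m) ^ 2 := by
  rw [dyadicSquare_eq_preimage hs, (PiLp.volume_preserving_ofLp (Fin 2)).measure_preimage
    (MeasurableSet.univ_pi fun i => measurableSet_Ico).nullMeasurableSet, Real.volume_pi_Ico]
  simp

theorem dist_le_of_mem_dyadicSquare {s : ℝ} (hs : 0 < s) {m : ℕ} {k : Fin 2 → ℤ} {x y : Plane}
    (hx : x ∈ dyadicSquare s m k) (hy : y ∈ dyadicSquare s m k) :
    dist x y ≤ 2 * (s / 2 ^ m) := by
  have hl : 0 < s / 2 ^ m := by positivity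
  rw [dyadicSquare_eq_preimage hs] at hx hy
  simp only [mem_preimage, mem_univ_pi, mem_Ico] at hx hy
  have h : ∀ i, dist (x i) (y i) ^ 2 ≤ (s / 2 ^ m) ^ 2 := by
    intro i
    rw [Real.dist_eq, sq_abs]
    refine sq_le_sq' ?_ ?_ <;> linarith [(hx i).1, (hx i).2, (hy i).1, (hy i).2]
  rw [EuclideanSpace.dist_eq]
  refine Real.sqrt_le_iff.2 ⟨by positivity, ?_⟩
  rw [Fin.sum_univ_two]
  nlinarith [h 0, h 1, sq_nonneg (s / 2 ^ m)]

theorem exists_calderonZygmund_decomposition {f : Plane → ℝ} (hf : Continuous f)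
    (hfi : Integrable f) {l : ℝ} (hl : 0 < l) :
    ∃ (ι : Type) (_ : Countable ι) (S : ι → Set Plane) (c : ι → Plane) (r : ι → ℝ),
      (∀ i, MeasurableSet (S i)) ∧ Pairwise (Function.onFun Disjoint S) ∧
      (∀ i, 0 < r i) ∧ (∀ i, S i ⊆ Metric.closedBall (c i) (r i)) ∧
      (∀ i, volume (Metric.closedBall (c i) (2 * r i)) ≤ 64 * volume (S i)) ∧
      (∀ i, volume (S i) ≠ 0 ∧ volume (S i) ≠ ⊤) ∧
      (∀ i, ENNReal.ofReal l * volume (S i) ≤ ∫⁻ x in S i, ‖f x‖ₑ) ∧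
      (∀ i, ∫⁻ x in S i, ‖f x‖ₑ ≤ ENNReal.ofReal (4 * l) * volume (S i)) ∧
      ∀ x, x ∉ ⋃ i, S i → |f x| ≤ l := by
  classical
  obtain ⟨s, hs, hfs⟩ : ∃ s : ℝ, 0 < s ∧
      ∫⁻ x, ‖f x‖ₑ ≤ ENNReal.ofReal l * ENNReal.ofReal s ^ 2 := by
    set N := ∫ x, ‖f x‖
    have hN : 0 ≤ N := integral_nonneg fun _ => norm_nonneg _
    refine ⟨√((N + 1) / l), by positivity, ?_⟩
    rw [← ENNReal.ofReal_pow (by positivity), ← ENNReal.ofReal_mul hl.le,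
      Real.sq_sqrt (by positivity),
      ← ofReal_integral_norm_eq_lintegral_enorm hfi]
    apply ENNReal.ofReal_le_ofReal
    have : l * ((N + 1) / l) = N + 1 := by field_simp
    rw [this]; linarith
  set bad : ℕ → (Fin 2 → ℤ) → Prop := fun m k =>
    ENNReal.ofReal l * volume (dyadicSquare s m k) < ∫⁻ x in dyadicSquare s m k, ‖f x‖ₑ
  set good : ℕ → (Fin 2 → ℤ) → Prop := fun m k =>
    bad m k ∧ ∃ z ∈ dyadicSquare s m k, ∀ m' < m, ¬ bad m' (dyadicIndex s m' z)
  have mem_self : ∀ m x, x ∈ dyadicSquare s m (dyadicIndex s m x) := fun m x => rfl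
  choose! z hz hzb using fun (p : {p : ℕ × (Fin 2 → ℤ) // good p.1 p.2}) => p.2.2
  refine ⟨{p : ℕ × (Fin 2 → ℤ) // good p.1 p.2}, inferInstance,
    fun p => dyadicSquare s p.1.1 p.1.2, z, fun p => 2 * (s / 2 ^ p.1.1),
    fun p => measurableSet_dyadicSquare hs _ _, ?_, fun p => by positivity, ?_, ?_, ?_, ?_, ?_, ?_⟩
  · intro p q hpq
    rw [Function.onFun, Set.disjoint_left]
    intro x hxp hxq
    have aux : ∀ p q : {p : ℕ × (Fin 2 → ℤ) // good p.1 p.2}, x ∈ dyadicSquare s p.1.1 p.1.2 →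
        x ∈ dyadicSquare s q.1.1 q.1.2 → ¬ p.1.1 < q.1.1 := by
      intro p q hxp hxq hlt
      apply hzb q p.1.1 hlt
      have : dyadicIndex s q.1.1 (z q) = dyadicIndex s q.1.1 x := (hz q).trans hxq.symm
      rw [dyadicIndex_eq_of_le hlt.le this, show dyadicIndex s p.1.1 x = p.1.2 from hxp]
      exact p.2.1
    have h1 : p.1.1 = q.1.1 := le_antisymm (not_lt.1 (aux q p hxq hxp)) (not_lt.1 (aux p q hxp hxq))
    apply hpq
    ext1
    refine Prod.ext h1 ?_
    rw [← show dyadicIndex s p.1.1 x = p.1.2 from hxp, h1]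
    exact hxq
  · intro p x hx
    exact dist_le_of_mem_dyadicSquare hs hx (hz p)
  · intro p
    have hpi : ENNReal.ofReal Real.pi ≤ 4 := by
      rw [show (4 : ℝ≥0∞) = ENNReal.ofReal 4 by simp]
      exact ENNReal.ofReal_le_ofReal Real.pi_le_four
    rw [EuclideanSpace.volume_closedBall_fin_two, volume_dyadicSquare hs,
      ENNReal.ofReal_mul (by norm_num), ENNReal.ofReal_mul (by norm_num)]
    calc _ ≤ (ENNReal.ofReal 2 * (ENNReal.ofReal 2 * ENNReal.ofReal (s / 2 ^ p.1.1))) ^ 2 * 4 := by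
          gcongr
      _ = _ := by simp only [ENNReal.ofReal_ofNat]; ring
  · intro p
    rw [volume_dyadicSquare hs]
    have : 0 < s / 2 ^ p.1.1 := by positivity
    exact ⟨by simp [this], by simp⟩
  · exact fun p => p.2.1.le
  · rintro ⟨⟨m, k⟩, hp⟩
    obtain ⟨hb, w, hw, hwb⟩ := hp
    dsimp only at hb hw hwb ⊢
    cases m with
    | zero =>
      exfalso
      refine absurd hb (not_lt.2 ?_)
      rw [volume_dyadicSquare hs]
      simpa using (setLIntegral_le_lintegral _ _).trans hfs
    | succ m =>
      have hsub : dyadicSquare s (m + 1) k ⊆ dyadicSquare s m (dyadicIndex s m w) := fun x hx =>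
        dyadicIndex_eq_of_succ (hx.trans hw.symm)
      have h1 := not_lt.1 (hwb m (Nat.lt_succ_self m))
      refine (lintegral_mono_set hsub).trans (h1.trans (le_of_eq ?_))
      rw [volume_dyadicSquare hs, volume_dyadicSquare hs,
        show s / 2 ^ m = 2 * (s / 2 ^ (m + 1)) by field_simp; ring,
        ENNReal.ofReal_mul (by norm_num), ENNReal.ofReal_mul (by norm_num)]
      simp only [ENNReal.ofReal_ofNat]; ring
  · intro x hx
    by_contra! hlt
    obtain ⟨δ, hδ, hball⟩ := Metric.isOpen_iff.1 (isOpen_lt continuous_const hf.abs) x hlt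
    obtain ⟨n, hn⟩ : ∃ n : ℕ, 2 * (s / 2 ^ n) < δ := by
      have : Tendsto (fun n : ℕ => 2 * (s / 2 ^ n)) atTop (𝓝 (2 * 0)) := by
        refine Tendsto.const_mul _ ?_
        exact tendsto_const_nhds.div_atTop (tendsto_pow_atTop_atTop_of_one_lt (by norm_num))
      rw [mul_zero] at this
      exact (this.eventually (gt_mem_nhds hδ)).exists
    have hbad : ∃ n, bad n (dyadicIndex s n x) := by
      refine ⟨n, ?_⟩
      have hv := volume_dyadicSquare hs n (dyadicIndex s n x)
      have hpos : 0 < s / 2 ^ n := by positivity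
      have h3 : ∀ y ∈ dyadicSquare s n (dyadicIndex s n x), ENNReal.ofReal l < ‖f y‖ₑ := by
        intro y hy
        have : l < |f y| := hball ((dist_le_of_mem_dyadicSquare hs hy (mem_self n x)).trans_lt hn)
        rw [Real.enorm_eq_ofReal_abs]
        exact (ENNReal.ofReal_lt_ofReal_iff (hl.trans this)).2 this
      have := setLIntegral_strict_mono (μ := volume) (f := fun _ => ENNReal.ofReal l)
        (g := fun y => ‖f y‖ₑ) (measurableSet_dyadicSquare hs n (dyadicIndex s n x))
        (by rw [hv]; simp [hpos]) hf.measurable.enorm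
        (by rw [setLIntegral_const, hv]; exact ENNReal.mul_ne_top (by simp) (by simp))
        (Eventually.of_forall h3)
      rwa [setLIntegral_const] at this
    refine hx (mem_iUnion.2 ⟨⟨(Nat.find hbad, dyadicIndex s (Nat.find hbad) x),
      Nat.find_spec hbad, x, mem_self _ _, fun m' hm' => Nat.find_min hbad hm'⟩, mem_self _ _⟩)

/-- The convolution operator with kernel `K`. -/
def kernelOp (K f : Plane → ℝ) (x : Plane) : ℝ := ∫ y, K (x - y) * f y

/-- Bounded even kernels on the plane whose convolution operator is bounded on `L²` with constant
`A`, and which satisfy the Hörmander regularity condition with constant `H`. -/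
structure IsCalderonZygmundKernel (K : Plane → ℝ) (A H : NNReal) : Prop where
  continuous : Continuous K
  bounded : ∃ B, ∀ z, ‖K z‖ ≤ B
  even : ∀ z, K (-z) = K z
  l2_bound : ∀ f : Plane → ℝ, Integrable f → MemLp f 2 →
    ∫⁻ x, ‖kernelOp K f x‖ₑ ^ 2 ≤ A * ∫⁻ x, ‖f x‖ₑ ^ 2
  hormander : ∀ r : ℝ, 0 < r → ∀ y : Plane, ‖y‖ ≤ r →
    ∫⁻ x in (Metric.closedBall 0 (2 * r))ᶜ, ‖K (x - y) - K x‖ₑ ≤ H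

namespace IsCalderonZygmundKernel

variable {K : Plane → ℝ} {A H : NNReal}

theorem integrable_mul (hK : IsCalderonZygmundKernel K A H) {μ : Measure Plane} {f : Plane → ℝ}
    (hf : Integrable f μ) (x : Plane) : Integrable (fun y => K (x - y) * f y) μ := by
  obtain ⟨B, hB⟩ := hK.bounded
  refine hf.bdd_mul (c := B) ?_ (Eventually.of_forall fun y => hB _)
  exact (hK.continuous.comp (continuous_const.sub continuous_id)).aestronglyMeasurable

theorem continuous_kernelOp (hK : IsCalderonZygmundKernel K A H) {f : Plane → ℝ}
    (hf : Integrable f) : Continuous (kernelOp K f) := by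
  obtain ⟨B, hB⟩ := hK.bounded
  refine continuous_of_dominated (bound := fun y => B * ‖f y‖)
    (fun x => (hK.integrable_mul hf x).aestronglyMeasurable)
    (fun x => Eventually.of_forall fun y => ?_) (hf.norm.const_mul B)
    (Eventually.of_forall fun y => ?_)
  · rw [norm_mul]
    gcongr
    exact hB _
  · exact (hK.continuous.comp (continuous_id.sub continuous_const)).mul continuous_const

theorem kernelOp_add (hK : IsCalderonZygmundKernel K A H) {f g : Plane → ℝ}
    (hf : Integrable f) (hg : Integrable g) (x : Plane) :
    kernelOp K (fun y => f y + g y) x = kernelOp K f x + kernelOp K g x := by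
  simp only [kernelOp, mul_add]
  exact integral_add (hK.integrable_mul hf x) (hK.integrable_mul hg x)

theorem lintegral_compl_closedBall_le (hK : IsCalderonZygmundKernel K A H) {b : Plane → ℝ}
    {S : Set Plane} {c : Plane} {r : ℝ} (hr : 0 < r) (hSm : MeasurableSet S)
    (hS : S ⊆ Metric.closedBall c r) (hb : IntegrableOn b S) (hb0 : ∫ y in S, b y = 0) :
    ∫⁻ x in (Metric.closedBall c (2 * r))ᶜ, ‖∫ y in S, K (x - y) * b y‖ₑ
      ≤ H * ∫⁻ y in S, ‖b y‖ₑ := by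
  have hKm := hK.continuous.measurable
  have h1 : ∀ x, ‖∫ y in S, K (x - y) * b y‖ₑ
      ≤ ∫⁻ y in S, ‖K (x - y) - K (x - c)‖ₑ * ‖b y‖ₑ := by
    intro x
    have : ∫ y in S, K (x - y) * b y = ∫ y in S, (K (x - y) - K (x - c)) * b y := by
      simp only [sub_mul]
      rw [integral_sub (hK.integrable_mul hb x) (hb.const_mul _), integral_const_mul, hb0]
      simp
    rw [this]
    refine (enorm_integral_le_lintegral_enorm _).trans (le_of_eq ?_)
    simp only [enorm_mul]
  have h2 : ∀ y ∈ S, ∫⁻ x in (Metric.closedBall c (2 * r))ᶜ, ‖K (x - y) - K (x - c)‖ₑ ≤ H := by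
    intro y hy
    refine le_trans (le_of_eq ?_) (hK.hormander r hr (y - c) (by simpa [dist_eq_norm] using hS hy))
    have hm : ∀ d : Plane, MeasurableSet (Metric.closedBall d (2 * r))ᶜ := fun d =>
      Metric.isClosed_closedBall.measurableSet.compl
    rw [← lintegral_indicator (hm _), ← lintegral_indicator (hm _)]
    refine Eq.trans ?_ (lintegral_sub_right_eq_self _ c)
    congr 1
    ext x
    simp only [indicator, mem_compl_iff, Metric.mem_closedBall, dist_eq_norm, sub_zero,
      sub_sub_sub_cancel_right]
  calc _ ≤ ∫⁻ x in (Metric.closedBall c (2 * r))ᶜ,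
        ∫⁻ y in S, ‖K (x - y) - K (x - c)‖ₑ * ‖b y‖ₑ := lintegral_mono h1
    _ = ∫⁻ y in S, ∫⁻ x in (Metric.closedBall c (2 * r))ᶜ,
        ‖K (x - y) - K (x - c)‖ₑ * ‖b y‖ₑ := by
      refine lintegral_lintegral_swap ?_
      refine AEMeasurable.mul ?_ hb.aestronglyMeasurable.enorm.comp_snd
      exact Measurable.aemeasurable (by fun_prop)
    _ = ∫⁻ y in S, (∫⁻ x in (Metric.closedBall c (2 * r))ᶜ, ‖K (x - y) - K (x - c)‖ₑ) * ‖b y‖ₑ := by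
      refine lintegral_congr fun y => ?_
      rw [lintegral_mul_const]
      fun_prop
    _ ≤ ∫⁻ y in S, H * ‖b y‖ₑ := by
      refine setLIntegral_mono_ae' hSm (Eventually.of_forall fun y hy => ?_)
      gcongr
      exact h2 y hy
    _ = H * ∫⁻ y in S, ‖b y‖ₑ := lintegral_const_mul' _ _ (by simp)

theorem mul_volume_le (hK : IsCalderonZygmundKernel K A H) {f : Plane → ℝ} (hf : Continuous f)
    (hfi : Integrable f) {t : ℝ} (ht : 0 < t) :
    ENNReal.ofReal t * volume {x | t < |kernelOp K f x|} ≤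
      (64 + 16 * A + 4 * H) * ∫⁻ x, ‖f x‖ₑ := by
  classical
  obtain ⟨ι, _, S, c, r, hSm, hSd, hr, hSb, hvol, hS0, hlow, hup, hout⟩ :=
    exists_calderonZygmund_decomposition hf hfi ht
  set N := ∫⁻ x, ‖f x‖ₑ with hN
  set T := ENNReal.ofReal t with hT
  have hT0 : T ≠ 0 := by simpa [hT] using ht
  have hTt : T ≠ ⊤ := ENNReal.ofReal_ne_top
  have hΩ : MeasurableSet (⋃ i, S i) := MeasurableSet.iUnion hSm
  have hsum : ∑' i, ∫⁻ x in S i, ‖f x‖ₑ ≤ N := by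
    rw [← lintegral_iUnion hSm hSd]
    exact setLIntegral_le_lintegral _ _
  -- the good part
  set a : ι → ℝ := fun i => (∫ x in S i, f x) / (volume (S i)).toReal with ha
  set g : Plane → ℝ := fun x => if h : ∃ i, x ∈ S i then a h.choose else f x with hg
  have hgS : ∀ i, ∀ x ∈ S i, g x = a i := by
    intro i x hx
    have h : ∃ i, x ∈ S i := ⟨i, hx⟩
    have : h.choose = i := by
      by_contra hne
      exact Set.disjoint_left.1 (hSd hne) h.choose_spec hx
    simp only [hg, dif_pos h, this]
  have hgc : ∀ x ∈ (⋃ i, S i)ᶜ, g x = f x := by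
    intro x hx
    have : ¬ ∃ i, x ∈ S i := by simpa using hx
    simp only [hg, dif_neg this]
  have hav : ∀ i, ‖a i‖ₑ * volume (S i) ≤ ∫⁻ x in S i, ‖f x‖ₑ := by
    intro i
    have h0 : 0 < (volume (S i)).toReal := ENNReal.toReal_pos (hS0 i).1 (hS0 i).2
    have : ‖a i‖ₑ * volume (S i) = ‖∫ x in S i, f x‖ₑ := by
      conv_lhs => rw [← ENNReal.ofReal_toReal (hS0 i).2, ← Real.enorm_of_nonneg h0.le, ← enorm_mul]
      rw [ha, div_mul_cancel₀ _ h0.ne']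
    rw [this]
    exact enorm_integral_le_lintegral_enorm _
  have hab : ∀ i, ‖a i‖ₑ ≤ ENNReal.ofReal (4 * t) := fun i =>
    (ENNReal.mul_le_mul_iff_left (hS0 i).1 (hS0 i).2).1 ((hav i).trans (hup i))
  have hgb : ∀ x, ‖g x‖ₑ ≤ ENNReal.ofReal (4 * t) := by
    intro x
    by_cases hx : x ∈ ⋃ i, S i
    · obtain ⟨i, hi⟩ := mem_iUnion.1 hx
      rw [hgS i x hi]
      exact hab i
    · rw [hgc x hx, Real.enorm_eq_ofReal_abs]
      exact ENNReal.ofReal_le_ofReal ((hout x hx).trans (by linarith))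
  have hgm : AEStronglyMeasurable g volume := by
    rw [← Measure.restrict_univ (μ := volume), ← union_compl_self (⋃ i, S i),
      aestronglyMeasurable_union_iff, aestronglyMeasurable_iUnion_iff]
    refine ⟨fun i => ?_, ?_⟩
    · refine (aestronglyMeasurable_const (b := a i)).congr ?_
      exact (ae_restrict_of_forall_mem (hSm i) fun x hx => (hgS i x hx).symm)
    · refine hf.aestronglyMeasurable.congr ?_
      exact (ae_restrict_of_forall_mem hΩ.compl fun x hx => (hgc x hx).symm)
  have hgSi : ∀ i, ∫⁻ x in S i, ‖g x‖ₑ ≤ ∫⁻ x in S i, ‖f x‖ₑ := by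
    intro i
    rw [setLIntegral_congr_fun (hSm i) (fun x hx => by rw [hgS i x hx]), setLIntegral_const]
    exact hav i
  have hgN : ∫⁻ x, ‖g x‖ₑ ≤ N := by
    rw [hN, ← lintegral_add_compl (fun x => ‖g x‖ₑ) hΩ, ← lintegral_add_compl (fun x => ‖f x‖ₑ) hΩ,
      lintegral_iUnion hSm hSd, lintegral_iUnion hSm hSd,
      setLIntegral_congr_fun hΩ.compl (fun x hx => by rw [hgc x hx])]
    exact add_le_add_left (ENNReal.tsum_le_tsum hgSi) _
  have hgi : Integrable g := ⟨hgm, hgN.trans_lt hfi.2⟩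
  have hg2 : ∫⁻ x, ‖g x‖ₑ ^ 2 ≤ ENNReal.ofReal (4 * t) * N := by
    calc _ ≤ ∫⁻ x, ENNReal.ofReal (4 * t) * ‖g x‖ₑ := by
          refine lintegral_mono fun x => ?_
          rw [sq]
          gcongr
          exact hgb x
      _ = ENNReal.ofReal (4 * t) * ∫⁻ x, ‖g x‖ₑ := lintegral_const_mul' _ _ ENNReal.ofReal_ne_top
      _ ≤ _ := by gcongr
  have hgL2 : MemLp g 2 := by
    refine ⟨hgm, ?_⟩
    rw [eLpNorm_lt_top_iff_lintegral_rpow_enorm_lt_top (by norm_num) (by norm_num)]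
    simp only [ENNReal.toReal_ofNat, ENNReal.rpow_ofNat]
    exact hg2.trans_lt (ENNReal.mul_lt_top ENNReal.ofReal_lt_top hfi.2)
  -- the bad part
  set b : Plane → ℝ := fun x => f x - g x with hb
  have hbi : Integrable b := hfi.sub hgi
  have hb0 : ∀ i, ∫ x in S i, b x = 0 := by
    intro i
    have h0 : 0 < (volume (S i)).toReal := ENNReal.toReal_pos (hS0 i).1 (hS0 i).2
    rw [hb, integral_sub hfi.integrableOn hgi.integrableOn,
      setIntegral_congr_fun (g := fun _ => a i) (hSm i) (fun x hx => hgS i x hx), setIntegral_const,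
      smul_eq_mul, Measure.real, ha, mul_div_cancel₀ _ h0.ne', sub_self]
  have hbN : ∀ i, ∫⁻ x in S i, ‖b x‖ₑ ≤ 2 * ∫⁻ x in S i, ‖f x‖ₑ := by
    intro i
    calc _ ≤ ∫⁻ x in S i, (‖f x‖ₑ + ‖g x‖ₑ) := lintegral_mono fun x => enorm_sub_le
      _ = (∫⁻ x in S i, ‖f x‖ₑ) + ∫⁻ x in S i, ‖g x‖ₑ := lintegral_add_left hf.measurable.enorm _
      _ ≤ _ := by rw [two_mul]; exact add_le_add_right (hgSi i) _
  have hKb : ∀ x, ‖kernelOp K b x‖ₑ ≤ ∑' i, ‖∫ y in S i, K (x - y) * b y‖ₑ := by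
    intro x
    have h1 : kernelOp K b x = ∫ y in ⋃ i, S i, K (x - y) * b y := by
      refine (setIntegral_eq_integral_of_forall_compl_eq_zero fun y hy => ?_).symm
      simp [hb, hgc y hy]
    rw [h1, ← (hasSum_integral_iUnion hSm hSd (hK.integrable_mul hbi x).integrableOn).tsum_eq]
    exact enorm_tsum_le_tsum_enorm
  set U := ⋃ i, Metric.closedBall (c i) (2 * r i) with hU
  have hUm : MeasurableSet U :=
    MeasurableSet.iUnion fun i => Metric.isClosed_closedBall.measurableSet
  have hbad : ∫⁻ x in Uᶜ, ‖kernelOp K b x‖ₑ ≤ 2 * H * N := by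
    have hmeas : ∀ i, Measurable fun x => ‖∫ y in S i, K (x - y) * b y‖ₑ := by
      intro i
      have := (hK.continuous_kernelOp ((integrable_indicator_iff (hSm i)).2
        hbi.integrableOn)).measurable.enorm
      convert this using 3 with x
      rw [kernelOp, ← integral_indicator (hSm i)]
      congr 1
      ext y
      by_cases hy : y ∈ S i <;> simp [hy]
    calc _ ≤ ∫⁻ x in Uᶜ, ∑' i, ‖∫ y in S i, K (x - y) * b y‖ₑ := lintegral_mono hKb
      _ = ∑' i, ∫⁻ x in Uᶜ, ‖∫ y in S i, K (x - y) * b y‖ₑ :=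
        lintegral_tsum fun i => (hmeas i).aemeasurable
      _ ≤ ∑' i, (2 * H) * ∫⁻ x in S i, ‖f x‖ₑ := by
        refine ENNReal.tsum_le_tsum fun i => ?_
        calc _ ≤ ∫⁻ x in (Metric.closedBall (c i) (2 * r i))ᶜ, ‖∫ y in S i, K (x - y) * b y‖ₑ :=
              lintegral_mono_set (compl_subset_compl.2
                (subset_iUnion (fun i => Metric.closedBall (c i) (2 * r i)) i))
          _ ≤ H * ∫⁻ y in S i, ‖b y‖ₑ :=
              hK.lintegral_compl_closedBall_le (hr i) (hSm i) (hSb i) hbi.integrableOn (hb0 i)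
          _ ≤ H * (2 * ∫⁻ y in S i, ‖f y‖ₑ) := by gcongr; exact hbN i
          _ = _ := by ring
      _ ≤ 2 * H * N := by
        rw [ENNReal.tsum_mul_left]
        gcongr
  -- assembling the three contributions
  have hV1 : T * volume U ≤ 64 * N := by
    calc _ ≤ T * ∑' i, 64 * volume (S i) := by
          gcongr
          exact (measure_iUnion_le _).trans (ENNReal.tsum_le_tsum hvol)
      _ = 64 * ∑' i, T * volume (S i) := by
          rw [ENNReal.tsum_mul_left, ENNReal.tsum_mul_left]; ring
      _ ≤ 64 * N := by
          gcongr
          exact (ENNReal.tsum_le_tsum hlow).trans hsum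
  have hT2 : 2 * ENNReal.ofReal (t / 2) = T := by
    rw [← ENNReal.ofReal_ofNat 2, ← ENNReal.ofReal_mul (by norm_num), hT]
    congr 1
    ring
  have hV2 : T * volume {x | ENNReal.ofReal (t / 2) ≤ ‖kernelOp K g x‖ₑ} ≤ 16 * A * N := by
    have h1 := mul_meas_ge_le_lintegral₀ (μ := volume)
      ((hK.continuous_kernelOp hgi).measurable.enorm.pow_const 2).aemeasurable
      (ENNReal.ofReal (t / 2) ^ 2)
    have h2 : {x | ENNReal.ofReal (t / 2) ≤ ‖kernelOp K g x‖ₑ} ⊆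
        {x | ENNReal.ofReal (t / 2) ^ 2 ≤ ‖kernelOp K g x‖ₑ ^ 2} := fun x hx => by
      simp only [mem_ofPred_eq] at hx ⊢
      gcongr
    have h3 := (mul_le_mul_right (measure_mono h2) (ENNReal.ofReal (t / 2) ^ 2)).trans
      (h1.trans ((hK.l2_bound g hgi hgL2).trans (mul_le_mul_right hg2 _)))
    refine (ENNReal.mul_le_mul_iff_right hT0 hTt).1 ?_
    calc _ = 4 * (ENNReal.ofReal (t / 2) ^ 2 *
          volume {x | ENNReal.ofReal (t / 2) ≤ ‖kernelOp K g x‖ₑ}) := by rw [← hT2]; ring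
      _ ≤ 4 * (A * (ENNReal.ofReal (4 * t) * N)) := by gcongr
      _ = _ := by rw [ENNReal.ofReal_mul (by norm_num), ENNReal.ofReal_ofNat]; ring
  have hV3 : T * volume ({x | ENNReal.ofReal (t / 2) ≤ ‖kernelOp K b x‖ₑ} ∩ Uᶜ) ≤ 4 * H * N := by
    have h1 := mul_meas_ge_le_lintegral₀ (μ := volume.restrict Uᶜ)
      (hK.continuous_kernelOp hbi).measurable.enorm.aemeasurable (ENNReal.ofReal (t / 2))
    rw [Measure.restrict_apply' hUm.compl] at h1
    calc _ = 2 * (ENNReal.ofReal (t / 2) *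
          volume ({x | ENNReal.ofReal (t / 2) ≤ ‖kernelOp K b x‖ₑ} ∩ Uᶜ)) := by rw [← hT2]; ring
      _ ≤ 2 * (2 * H * N) := mul_le_mul_right (h1.trans hbad) _
      _ = _ := by ring
  have hcover : {x | t < |kernelOp K f x|} ⊆ U ∪
      ({x | ENNReal.ofReal (t / 2) ≤ ‖kernelOp K g x‖ₑ} ∪
        ({x | ENNReal.ofReal (t / 2) ≤ ‖kernelOp K b x‖ₑ} ∩ Uᶜ)) := by
    intro x hx
    by_cases hxU : x ∈ U
    · exact Or.inl hxU
    right
    by_contra hcon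
    simp only [mem_union, mem_inter_iff, not_or, not_and] at hcon
    have h1 : ¬ ENNReal.ofReal (t / 2) ≤ ‖kernelOp K g x‖ₑ := hcon.1
    have h2 : ¬ ENNReal.ofReal (t / 2) ≤ ‖kernelOp K b x‖ₑ := fun h => hcon.2 h hxU
    rw [Real.enorm_eq_ofReal_abs, ENNReal.ofReal_le_ofReal_iff (abs_nonneg _)] at h1 h2
    have h3 : kernelOp K f x = kernelOp K g x + kernelOp K b x := by
      rw [← hK.kernelOp_add hgi hbi]
      congr 1
      ext y
      simp [hb]
    have hx' : t < |kernelOp K f x| := hx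
    rw [h3] at hx'
    linarith [abs_add_le (kernelOp K g x) (kernelOp K b x)]
  calc _ ≤ T * (volume U + (volume {x | ENNReal.ofReal (t / 2) ≤ ‖kernelOp K g x‖ₑ} +
        volume ({x | ENNReal.ofReal (t / 2) ≤ ‖kernelOp K b x‖ₑ} ∩ Uᶜ))) := by
        gcongr
        refine (measure_mono hcover).trans ((measure_union_le _ _).trans ?_)
        gcongr
        exact measure_union_le _ _
    _ ≤ 64 * N + (16 * A * N + 4 * H * N) := by
        rw [mul_add, mul_add]
        gcongr
    _ = _ := by ring

theorem lintegral_enorm_sq_le_of_abs_le_one {f : Plane → ℝ} (hf1 : ∀ x, |f x| ≤ 1) :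
    ∫⁻ x, ‖f x‖ₑ ^ 2 ≤ ∫⁻ x, ‖f x‖ₑ := by
  refine lintegral_mono fun x => ?_
  have : ‖f x‖ₑ ≤ 1 := by
    rw [Real.enorm_eq_ofReal_abs]
    exact ENNReal.ofReal_le_one.2 (hf1 x)
  calc ‖f x‖ₑ ^ 2 = ‖f x‖ₑ * ‖f x‖ₑ := sq _
    _ ≤ ‖f x‖ₑ * 1 := by gcongr
    _ = _ := mul_one _

theorem le_mul_ofReal_rpow_neg {t β : ℝ} (ht : 0 < t) {a v : ℝ≥0∞}
    (h : ENNReal.ofReal t ^ β * v ≤ a) : v ≤ a * ENNReal.ofReal (t ^ (-β)) := by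
  rw [Real.rpow_neg ht.le, ENNReal.ofReal_inv_of_pos (by positivity), ← div_eq_mul_inv,
    ENNReal.le_div_iff_mul_le (Or.inl (by simp; positivity)) (Or.inl ENNReal.ofReal_ne_top),
    ← ENNReal.ofReal_rpow_of_pos ht, mul_comm]
  exact h

theorem volume_le_weak_one (hK : IsCalderonZygmundKernel K A H) {f : Plane → ℝ}
    (hf : Continuous f) (hfi : Integrable f) {t : ℝ} (ht : 0 < t) :
    volume {x | t < |kernelOp K f x|} ≤
      ((64 + 16 * A + 4 * H) * ∫⁻ x, ‖f x‖ₑ) * ENNReal.ofReal (t ^ (-(1 : ℝ))) := by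
  apply le_mul_ofReal_rpow_neg ht
  rw [ENNReal.rpow_one]
  exact hK.mul_volume_le hf hfi ht

theorem volume_le_weak_two (hK : IsCalderonZygmundKernel K A H) {f : Plane → ℝ}
    (hf : Continuous f) (hfi : Integrable f) (hf1 : ∀ x, |f x| ≤ 1) {t : ℝ} (ht : 0 < t) :
    volume {x | t < |kernelOp K f x|} ≤
      ((64 + 16 * A + 4 * H) * ∫⁻ x, ‖f x‖ₑ) * ENNReal.ofReal (t ^ (-(2 : ℝ))) := by
  apply le_mul_ofReal_rpow_neg ht
  have h2 := lintegral_enorm_sq_le_of_abs_le_one hf1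
  have hfL2 : MemLp f 2 := by
    refine ⟨hf.aestronglyMeasurable, ?_⟩
    rw [eLpNorm_lt_top_iff_lintegral_rpow_enorm_lt_top (by norm_num) (by norm_num)]
    simp only [ENNReal.toReal_ofNat, ENNReal.rpow_ofNat]
    exact h2.trans_lt hfi.2
  have h1 := mul_meas_ge_le_lintegral₀ (μ := volume)
    ((hK.continuous_kernelOp hfi).measurable.enorm.pow_const 2).aemeasurable
    (ENNReal.ofReal t ^ 2)
  have hsub : {x | t < |kernelOp K f x|} ⊆
      {x | ENNReal.ofReal t ^ 2 ≤ ‖kernelOp K f x‖ₑ ^ 2} := fun x hx => by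
    simp only [mem_ofPred_eq] at hx ⊢
    rw [Real.enorm_eq_ofReal_abs]
    gcongr
  rw [ENNReal.rpow_ofNat]
  calc _ ≤ ENNReal.ofReal t ^ 2 * volume {x | ENNReal.ofReal t ^ 2 ≤ ‖kernelOp K f x‖ₑ ^ 2} := by
        gcongr
    _ ≤ A * ∫⁻ x, ‖f x‖ₑ := h1.trans ((hK.l2_bound f hfi hfL2).trans (by gcongr))
    _ ≤ _ := by
      gcongr
      calc (A : ℝ≥0∞) = 0 + 1 * A + 0 := by simp
        _ ≤ 64 + 16 * A + 4 * H := by gcongr <;> norm_num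

theorem integral_kernelOp_mul (hK : IsCalderonZygmundKernel K A H) {f g : Plane → ℝ}
    (hf : Integrable f) (hg : Integrable g) :
    ∫ x, kernelOp K f x * g x = ∫ x, f x * kernelOp K g x := by
  obtain ⟨B, hB⟩ := hK.bounded
  have h : Integrable (Function.uncurry fun x y => K (x - y) * f y * g x)
      ((volume : Measure Plane).prod volume) := by
    have h1 : Integrable (fun z : Plane × Plane => g z.1 * f z.2) (volume.prod volume) :=
      hg.mul_prod hf
    have h2 := h1.bdd_mul (c := B) (f := fun z : Plane × Plane => K (z.1 - z.2))
      (hK.continuous.comp (continuous_fst.sub continuous_snd)).aestronglyMeasurable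
      (Eventually.of_forall fun z => hB _)
    refine h2.congr (Eventually.of_forall fun z => ?_)
    simp only [Function.uncurry]
    ring
  calc _ = ∫ x, ∫ y, K (x - y) * f y * g x := by simp only [kernelOp, integral_mul_const]
    _ = ∫ y, ∫ x, K (x - y) * f y * g x := integral_integral_swap h
    _ = _ := by
      refine integral_congr_ae (Eventually.of_forall fun y => ?_)
      simp only [kernelOp]
      rw [← integral_const_mul]
      congr 1
      ext x
      rw [← hK.even (x - y), neg_sub]
      ring

theorem kernelOp_const_mul (c : ℝ) (f : Plane → ℝ) (x : Plane) :
    kernelOp K (fun y => c * f y) x = c * kernelOp K f x := by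
  simp only [kernelOp]
  rw [← integral_const_mul]
  congr 1
  ext y
  ring

theorem exists_lintegral_rpow_le_of_lt_two (A H : NNReal) {q : ℝ} (hq1 : 1 < q) (hq2 : q < 2) :
    ∃ C : NNReal, ∀ K : Plane → ℝ, IsCalderonZygmundKernel K A H → ∀ f : Plane → ℝ,
      Continuous f → Integrable f → (∀ x, |f x| ≤ 1) →
      ∫⁻ x, ENNReal.ofReal (|kernelOp K f x| ^ q) ≤ C * ∫⁻ x, ‖f x‖ₑ := by
  obtain ⟨C, hC⟩ := exists_lintegral_rpow_le_of_weak_type one_pos hq1 hq2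
  refine ⟨C * (64 + 16 * A + 4 * H), fun K hK f hf hfi hf1 => ?_⟩
  refine (hC volume _ _ (hK.continuous_kernelOp hfi).aemeasurable
    (fun t ht => hK.volume_le_weak_one hf hfi ht)
    (fun t ht => hK.volume_le_weak_two hf hfi hf1 ht)).trans (le_of_eq ?_)
  push_cast
  ring

theorem exists_volume_gt_le (A H : NNReal) {p : ℝ} (hp : 2 < p) :
    ∃ C : NNReal, ∀ K : Plane → ℝ, IsCalderonZygmundKernel K A H → ∀ f : Plane → ℝ,
      Continuous f → Integrable f → (∀ x, |f x| ≤ 1) → ∀ t : ℝ, 0 < t →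
      ENNReal.ofReal t ^ p * volume {x | t < kernelOp K f x} ≤ C * ∫⁻ x, ‖f x‖ₑ := by
  have hpq : p.HolderConjugate (p.conjExponent) := Real.HolderConjugate.conjExponent (by linarith)
  set q := p.conjExponent with hq
  have hp0 : 0 < p := by linarith
  have hq2 : q < 2 := by
    rw [hq, Real.conjExponent, div_lt_iff₀ (by linarith)]
    linarith
  obtain ⟨C, hC⟩ := exists_lintegral_rpow_le_of_lt_two A H hpq.symm.lt hq2
  have hq0 : 0 < q := hpq.symm.pos
  refine ⟨C ^ (p / q), fun K hK f hf hfi hf1 t ht => ?_⟩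
  have hF := hK.continuous_kernelOp hfi
  have hE : IsOpen {x | t < kernelOp K f x} := isOpen_lt continuous_const hF
  rw [hE.measure_eq_iSup_isCompact, ENNReal.mul_iSup]
  refine iSup_le fun k => ?_
  rw [ENNReal.mul_iSup]
  refine iSup_le fun hkE => ?_
  rw [ENNReal.mul_iSup]
  refine iSup_le fun hk => ?_
  obtain ⟨g, hg1, hg0, hgc, hg01⟩ := exists_continuous_one_zero_of_isCompact hk hE.isClosed_compl
    (disjoint_compl_right_iff_subset.2 hkE)
  have hgi : Integrable g := g.continuous.integrable_of_hasCompactSupport hgc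
  have hgb : ∀ x, |g x| ≤ 1 := fun x => by
    rw [abs_of_nonneg (hg01 x).1]
    exact (hg01 x).2
  set G := ∫⁻ x, ‖g x‖ₑ with hG
  set N := ∫⁻ x, ‖f x‖ₑ with hN
  set T := ENNReal.ofReal t with hT
  have hkG : volume k ≤ G := by
    rw [← setLIntegral_one, hG, ← lintegral_indicator hk.measurableSet]
    refine lintegral_mono fun x => ?_
    by_cases hx : x ∈ k
    · simp [hx, hg1 hx]
    · simp [hx]
  have hGt : G ≠ ⊤ := hgi.2.ne
  have hfp : ∫⁻ x, ‖f x‖ₑ ^ p ≤ N := by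
    refine lintegral_mono fun x => ?_
    have : ‖f x‖ₑ ≤ 1 := by
      rw [Real.enorm_eq_ofReal_abs]
      exact ENNReal.ofReal_le_one.2 (hf1 x)
    calc ‖f x‖ₑ ^ p ≤ ‖f x‖ₑ ^ (1 : ℝ) := ENNReal.rpow_le_rpow_of_exponent_ge this (by linarith)
      _ = _ := ENNReal.rpow_one _
  have hgq : ∫⁻ x, ‖kernelOp K g x‖ₑ ^ q ≤ C * G := by
    refine le_trans (le_of_eq (lintegral_congr fun x => ?_)) (hC K hK g g.continuous hgi hgb)
    rw [Real.enorm_eq_ofReal_abs, ENNReal.ofReal_rpow_of_nonneg (abs_nonneg _) hq0.le]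
  have hmain : T * G ≤ N ^ (1 / p) * (C * G) ^ (1 / q) := by
    obtain ⟨B, hB⟩ := hK.bounded
    have hFg : Integrable fun x => kernelOp K f x * g x :=
      (hF.mul g.continuous).integrable_of_hasCompactSupport hgc.mul_left
    calc T * G = ENNReal.ofReal (∫ x, t * g x) := by
          rw [integral_const_mul, ENNReal.ofReal_mul ht.le, hG,
            ← ofReal_integral_norm_eq_lintegral_enorm hgi]
          congr 3
          ext x
          rw [Real.norm_of_nonneg (hg01 x).1]
      _ ≤ ENNReal.ofReal (∫ x, kernelOp K f x * g x) := by
          refine ENNReal.ofReal_le_ofReal (integral_mono (hgi.const_mul t) hFg fun x => ?_)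
          by_cases hx : t < kernelOp K f x
          · exact mul_le_mul_of_nonneg_right hx.le (hg01 x).1
          · simp [hg0 (show x ∈ {x | t < kernelOp K f x}ᶜ from hx)]
      _ = ENNReal.ofReal (∫ x, f x * kernelOp K g x) := by rw [hK.integral_kernelOp_mul hfi hgi]
      _ ≤ ‖∫ x, f x * kernelOp K g x‖ₑ := by
          rw [Real.enorm_eq_ofReal_abs]
          exact ENNReal.ofReal_le_ofReal (le_abs_self _)
      _ ≤ ∫⁻ x, ‖f x‖ₑ * ‖kernelOp K g x‖ₑ := by
          refine (enorm_integral_le_lintegral_enorm _).trans (le_of_eq ?_)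
          simp only [enorm_mul]
      _ ≤ (∫⁻ x, ‖f x‖ₑ ^ p) ^ (1 / p) * (∫⁻ x, ‖kernelOp K g x‖ₑ ^ q) ^ (1 / q) :=
          ENNReal.lintegral_mul_le_Lp_mul_Lq volume hpq hf.measurable.enorm.aemeasurable
            (hK.continuous_kernelOp hgi).measurable.enorm.aemeasurable
      _ ≤ _ := by gcongr
  suffices h : T ^ p * G ≤ (C ^ (p / q) : NNReal) * N from (mul_le_mul_right hkG _).trans h
  rcases eq_or_ne G 0 with h0 | h0
  · simp [h0]
  have hGsplit : G = G ^ (1 / p) * G ^ (1 / q) := by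
    rw [← ENNReal.rpow_add _ _ h0 hGt, one_div, one_div, hpq.inv_add_inv_eq_one, ENNReal.rpow_one]
  have h3 : T * G ^ (1 / p) ≤ N ^ (1 / p) * C ^ (1 / q) := by
    have hc0 : G ^ (1 / q) ≠ 0 := by
      rw [ne_eq, ENNReal.rpow_eq_zero_iff]
      simp [h0, hGt]
    have hct : G ^ (1 / q) ≠ ⊤ := ENNReal.rpow_ne_top_of_nonneg (by positivity) hGt
    refine (ENNReal.mul_le_mul_iff_left hc0 hct).1 ?_
    rw [mul_assoc, ← hGsplit, mul_assoc, ← ENNReal.mul_rpow_of_nonneg _ _ (by positivity)]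
    exact hmain
  have h4 := ENNReal.rpow_le_rpow h3 hp0.le
  rw [ENNReal.mul_rpow_of_nonneg _ _ hp0.le, ENNReal.mul_rpow_of_nonneg _ _ hp0.le,
    ← ENNReal.rpow_mul, ← ENNReal.rpow_mul, ← ENNReal.rpow_mul, one_div_mul_cancel hp0.ne',
    ENNReal.rpow_one, ENNReal.rpow_one] at h4
  refine h4.trans (le_of_eq ?_)
  rw [mul_comm, ENNReal.coe_rpow_of_nonneg _ (by positivity)]
  congr 2
  ring

theorem exists_lintegral_rpow_le (A H : NNReal) {p : ℝ} (hp : 1 < p) :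
    ∃ C : NNReal, ∀ K : Plane → ℝ, IsCalderonZygmundKernel K A H → ∀ f : Plane → ℝ,
      Continuous f → Integrable f → (∀ x, |f x| ≤ 1) →
      ∫⁻ x, ENNReal.ofReal (|kernelOp K f x| ^ p) ≤ C * ∫⁻ x, ‖f x‖ₑ := by
  obtain ⟨C, hC⟩ := exists_lintegral_rpow_le_of_weak_type one_pos hp (lt_add_one p)
  obtain ⟨D, hD⟩ := exists_volume_gt_le A H (p := p + 1) (by linarith)
  refine ⟨C * ((64 + 16 * A + 4 * H) + 2 * D), fun K hK f hf hfi hf1 => ?_⟩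
  set N := ∫⁻ x, ‖f x‖ₑ with hN
  refine (hC volume _ (((64 + 16 * A + 4 * H) + 2 * D) * N)
    (hK.continuous_kernelOp hfi).aemeasurable
    (fun t ht => (hK.volume_le_weak_one hf hfi ht).trans ?_) (fun t ht => ?_)).trans (le_of_eq ?_)
  · exact mul_le_mul_left (mul_le_mul_left le_self_add _) _
  · apply le_mul_ofReal_rpow_neg ht
    have h1 := hD K hK f hf hfi hf1 t ht
    have h2 := hD K hK (fun x => -1 * f x) (hf.const_mul _) (hfi.const_mul _)
      (fun x => by simpa using hf1 x) t ht
    have h3 : ∫⁻ x, ‖-1 * f x‖ₑ = N := by simp [hN]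
    rw [h3] at h2
    have hsub : {x | t < |kernelOp K f x|} ⊆
        {x | t < kernelOp K f x} ∪ {x | t < kernelOp K (fun x => -1 * f x) x} := by
      intro x hx
      simp only [mem_union, mem_ofPred_eq, kernelOp_const_mul] at hx ⊢
      rw [neg_one_mul]
      exact lt_abs.1 hx
    calc _ ≤ ENNReal.ofReal t ^ (p + 1) * (volume {x | t < kernelOp K f x} +
          volume {x | t < kernelOp K (fun x => -1 * f x) x}) := by
          gcongr
          exact (measure_mono hsub).trans (measure_union_le _ _)
      _ ≤ D * N + D * N := by
          rw [mul_add]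
          exact add_le_add h1 h2
      _ = 2 * D * N := by ring
      _ ≤ _ := by
          gcongr
          exact le_add_self
  · push_cast
    ring

theorem exists_eLpNorm_le (A H : NNReal) {p : ℝ≥0∞} (hp : 1 < p) (hpt : p ≠ ⊤) :
    ∃ C : NNReal, ∀ K : Plane → ℝ, IsCalderonZygmundKernel K A H → ∀ f : Plane → ℝ,
      Continuous f → Integrable f → ∀ M : ℝ, 0 < M → (∀ x, |f x| ≤ M) →
      eLpNorm (kernelOp K f) p ≤ C * (eLpNorm f 1 + ENNReal.ofReal M) := by
  have hpr : 1 < p.toReal := by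
    rw [← ENNReal.toReal_one]
    exact (ENNReal.toReal_lt_toReal (by simp) hpt).2 hp
  set r := p.toReal with hr
  have hr0 : 0 < r := by linarith
  obtain ⟨C, hC⟩ := exists_lintegral_rpow_le A H hpr
  refine ⟨C ^ (1 / r), fun K hK f hf hfi M hM hfM => ?_⟩
  have h1 := hC K hK (fun x => M⁻¹ * f x) (hf.const_mul _) (hfi.const_mul _) (fun x => by
    rw [abs_mul, abs_of_pos (inv_pos.2 hM), inv_mul_le_one₀ hM]
    exact hfM x)
  set m := ENNReal.ofReal M with hm
  have hm0 : m ≠ 0 := by simpa [hm] using hM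
  have hmt : m ≠ ⊤ := ENNReal.ofReal_ne_top
  set N := ∫⁻ x, ‖f x‖ₑ with hN
  have h2 : ∫⁻ x, ‖M⁻¹ * f x‖ₑ = m⁻¹ * N := by
    simp only [enorm_mul]
    rw [lintegral_const_mul _ hf.measurable.enorm, Real.enorm_of_nonneg (by positivity),
      ENNReal.ofReal_inv_of_pos hM]
  have h3 : ∫⁻ x, ‖kernelOp K f x‖ₑ ^ r =
      m ^ r * ∫⁻ x, ENNReal.ofReal (|kernelOp K (fun x => M⁻¹ * f x) x| ^ r) := by
    rw [← lintegral_const_mul' _ _ (ENNReal.rpow_ne_top_of_nonneg hr0.le hmt)]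
    refine lintegral_congr fun x => ?_
    rw [kernelOp_const_mul, hm, ENNReal.ofReal_rpow_of_nonneg hM.le hr0.le,
      ← ENNReal.ofReal_mul (by positivity), ← Real.mul_rpow hM.le (abs_nonneg _),
      Real.enorm_eq_ofReal_abs, ENNReal.ofReal_rpow_of_nonneg (abs_nonneg _) hr0.le, abs_mul,
      abs_of_pos (inv_pos.2 hM), mul_inv_cancel_left₀ hM.ne']
  have h4 : ∫⁻ x, ‖kernelOp K f x‖ₑ ^ r ≤ C * (N + m) ^ r := by
    rw [h3]
    calc _ ≤ m ^ r * (C * (m⁻¹ * N)) := by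
          gcongr
          exact h1.trans_eq (by rw [h2])
      _ = C * (m ^ (r - 1) * N ^ (1 : ℝ)) := by
          rw [ENNReal.rpow_sub _ _ hm0 hmt, ENNReal.rpow_one, ENNReal.rpow_one, div_eq_mul_inv]
          ring
      _ ≤ C * ((N + m) ^ (r - 1) * (N + m) ^ (1 : ℝ)) := by
          have : 0 ≤ r - 1 := by linarith
          gcongr
          · exact le_add_self
          · exact le_self_add
      _ = C * (N + m) ^ r := by
          rw [← ENNReal.rpow_add_of_nonneg _ _ (by linarith) (by norm_num), sub_add_cancel]
  rw [eLpNorm_eq_lintegral_rpow_enorm_toReal (by positivity) hpt, eLpNorm_one_eq_lintegral_enorm]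
  refine (ENNReal.rpow_le_rpow h4 (by positivity)).trans (le_of_eq ?_)
  rw [ENNReal.mul_rpow_of_nonneg _ _ (by positivity), ← ENNReal.rpow_mul,
    mul_one_div_cancel hr0.ne', ENNReal.rpow_one, ENNReal.coe_rpow_of_nonneg _ (by positivity)]

end IsCalderonZygmundKernel

/-- The inverse regularised modulus `(‖z‖² + ε²)^{-1/2}`. -/
def invMod (ε : ℝ) (z : Plane) : ℝ := (√(‖z‖ ^ 2 + ε ^ 2))⁻¹

/-- The regularised field `⟪v, z⟫ / (‖z‖² + ε²)`. -/
def regField (ε : ℝ) (v z : Plane) : ℝ := ⟪v, z⟫ / (‖z‖ ^ 2 + ε ^ 2)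

/-- The derivative of `regField ε v` in the direction `w`. -/
def regKernel (ε : ℝ) (v w z : Plane) : ℝ :=
  ⟪v, w⟫ / (‖z‖ ^ 2 + ε ^ 2) - 2 * (⟪v, z⟫ * ⟪w, z⟫) / (‖z‖ ^ 2 + ε ^ 2) ^ 2

/-- The derivative of `regKernel ε v w` in the direction `u`. -/
def regKernelDeriv (ε : ℝ) (v w u z : Plane) : ℝ :=
  -2 * (⟪v, w⟫ * ⟪u, z⟫ + ⟪v, u⟫ * ⟪w, z⟫ + ⟪w, u⟫ * ⟪v, z⟫) / (‖z‖ ^ 2 + ε ^ 2) ^ 2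
    + 8 * (⟪v, z⟫ * ⟪w, z⟫ * ⟪u, z⟫) / (‖z‖ ^ 2 + ε ^ 2) ^ 3

section Regularised

variable {ε : ℝ}

theorem sq_norm_add_sq_pos (hε : 0 < ε) (z : Plane) : 0 < ‖z‖ ^ 2 + ε ^ 2 := by positivity

theorem invMod_pos (hε : 0 < ε) (z : Plane) : 0 < invMod ε z := by
  unfold invMod
  positivity

theorem sq_invMod (hε : 0 < ε) (z : Plane) : invMod ε z ^ 2 = (‖z‖ ^ 2 + ε ^ 2)⁻¹ := by
  rw [invMod, inv_pow, Real.sq_sqrt (sq_norm_add_sq_pos hε z).le]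

theorem norm_mul_invMod_le (hε : 0 < ε) (z : Plane) : ‖z‖ * invMod ε z ≤ 1 := by
  rw [invMod, ← div_eq_mul_inv, div_le_one (by positivity)]
  exact Real.le_sqrt_of_sq_le (by nlinarith [sq_nonneg ε])

theorem invMod_le (hε : 0 < ε) (z : Plane) : invMod ε z ≤ ε⁻¹ := by
  rw [invMod]
  gcongr
  exact Real.le_sqrt_of_sq_le (by nlinarith [sq_nonneg ‖z‖])

theorem abs_inner_mul_invMod_le (hε : 0 < ε) (v z : Plane) : |⟪v, z⟫ * invMod ε z| ≤ ‖v‖ := by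
  rw [abs_mul, abs_of_pos (invMod_pos hε z)]
  calc _ ≤ ‖v‖ * ‖z‖ * invMod ε z := by
        gcongr
        · exact (invMod_pos hε z).le
        · exact abs_real_inner_le_norm v z
    _ = ‖v‖ * (‖z‖ * invMod ε z) := by ring
    _ ≤ ‖v‖ := mul_le_of_le_one_right (norm_nonneg _) (norm_mul_invMod_le hε z)

theorem continuous_invMod (hε : 0 < ε) : Continuous (invMod ε) := by
  unfold invMod
  refine Continuous.inv₀ (by fun_prop) fun z => ?_
  positivity

theorem continuous_regField (hε : 0 < ε) (v : Plane) : Continuous (regField ε v) := by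
  unfold regField
  refine Continuous.div (by fun_prop) (by fun_prop) fun z => ?_
  positivity

theorem continuous_regKernel (hε : 0 < ε) (v w : Plane) : Continuous (regKernel ε v w) := by
  unfold regKernel
  refine (Continuous.div (by fun_prop) (by fun_prop) fun z => ?_).sub
    (Continuous.div (by fun_prop) (by fun_prop) fun z => ?_)
  all_goals positivity

theorem continuous_regKernelDeriv (hε : 0 < ε) (v w u : Plane) :
    Continuous (regKernelDeriv ε v w u) := by
  unfold regKernelDeriv
  refine (Continuous.div (by fun_prop) (by fun_prop) fun z => ?_).add
    (Continuous.div (by fun_prop) (by fun_prop) fun z => ?_)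
  all_goals positivity

theorem regKernel_neg (v w z : Plane) : regKernel ε v w (-z) = regKernel ε v w z := by
  simp [regKernel]

theorem regKernel_comm (v w z : Plane) : regKernel ε v w z = regKernel ε w v z := by
  simp only [regKernel, real_inner_comm v w, mul_comm ⟪v, z⟫]

theorem regKernelDeriv_swap (v w z : Plane) :
    regKernelDeriv ε v w w z = regKernelDeriv ε w w v z := by
  simp only [regKernelDeriv, real_inner_comm v w]
  ring

theorem abs_regField_le (hε : 0 < ε) {v : Plane} (hv : ‖v‖ ≤ 1) (z : Plane) :
    |regField ε v z| ≤ invMod ε z := by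
  have h : regField ε v z = (⟪v, z⟫ * invMod ε z) * invMod ε z := by
    rw [regField, mul_assoc, ← sq, sq_invMod hε, div_eq_mul_inv]
  rw [h, abs_mul, abs_of_pos (invMod_pos hε z)]
  exact mul_le_of_le_one_left (invMod_pos hε z).le ((abs_inner_mul_invMod_le hε v z).trans hv)

theorem abs_regKernel_le (hε : 0 < ε) {v w : Plane} (hv : ‖v‖ ≤ 1) (hw : ‖w‖ ≤ 1) (z : Plane) :
    |regKernel ε v w z| ≤ 3 * invMod ε z ^ 2 := by
  have h : regKernel ε v w z =
      (⟪v, w⟫ - 2 * ((⟪v, z⟫ * invMod ε z) * (⟪w, z⟫ * invMod ε z))) * invMod ε z ^ 2 := by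
    rw [regKernel, div_eq_mul_inv, div_eq_mul_inv, ← inv_pow, ← sq_invMod hε]
    ring
  rw [h, abs_mul, abs_of_pos (pow_pos (invMod_pos hε z) 2)]
  have ha := (abs_inner_mul_invMod_le hε v z).trans hv
  have hb := (abs_inner_mul_invMod_le hε w z).trans hw
  have hc : |⟪v, w⟫| ≤ 1 := (abs_real_inner_le_norm v w).trans
    (mul_le_one₀ hv (norm_nonneg _) hw)
  have hab := mul_le_one₀ ha (abs_nonneg _) hb
  gcongr
  refine (abs_sub _ _).trans ?_
  rw [abs_mul, abs_mul, abs_two]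
  linarith

theorem abs_regKernelDeriv_le (hε : 0 < ε) {v w : Plane} (hv : ‖v‖ ≤ 1) (hw : ‖w‖ ≤ 1)
    (u z : Plane) : |regKernelDeriv ε v w u z| ≤ 14 * ‖u‖ * invMod ε z ^ 3 := by
  have h : regKernelDeriv ε v w u z =
      (-2 * (⟪v, w⟫ * (⟪u, z⟫ * invMod ε z) + ⟪v, u⟫ * (⟪w, z⟫ * invMod ε z)
        + ⟪w, u⟫ * (⟪v, z⟫ * invMod ε z))
        + 8 * ((⟪v, z⟫ * invMod ε z) * (⟪w, z⟫ * invMod ε z) * (⟪u, z⟫ * invMod ε z)))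
        * invMod ε z ^ 3 := by
    rw [regKernelDeriv, div_eq_mul_inv, div_eq_mul_inv, ← inv_pow, ← inv_pow, ← sq_invMod hε]
    ring
  rw [h, abs_mul, abs_of_pos (pow_pos (invMod_pos hε z) 3)]
  have ha := (abs_inner_mul_invMod_le hε v z).trans hv
  have hb := (abs_inner_mul_invMod_le hε w z).trans hw
  have hc := abs_inner_mul_invMod_le hε u z
  have hvw : |⟪v, w⟫| ≤ 1 := (abs_real_inner_le_norm v w).trans
    (mul_le_one₀ hv (norm_nonneg _) hw)
  have hvu : |⟪v, u⟫| ≤ ‖u‖ := (abs_real_inner_le_norm v u).trans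
    (mul_le_of_le_one_left (norm_nonneg _) hv)
  have hwu : |⟪w, u⟫| ≤ ‖u‖ := (abs_real_inner_le_norm w u).trans
    (mul_le_of_le_one_left (norm_nonneg _) hw)
  have hs : 0 ≤ invMod ε z ^ 3 := (pow_pos (invMod_pos hε z) 3).le
  refine mul_le_mul_of_nonneg_right ?_ hs
  generalize ⟪v, z⟫ * invMod ε z = a at *
  generalize ⟪w, z⟫ * invMod ε z = b at *
  generalize ⟪u, z⟫ * invMod ε z = c at *
  generalize ⟪v, w⟫ = p at *
  generalize ⟪v, u⟫ = q at *
  generalize ⟪w, u⟫ = r at *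
  have h1 : |p * c| ≤ ‖u‖ := by
    rw [abs_mul]
    exact (mul_le_of_le_one_left (abs_nonneg _) hvw).trans hc
  have h2 : |q * b| ≤ ‖u‖ := by
    rw [abs_mul]
    exact (mul_le_of_le_one_right (abs_nonneg _) hb).trans hvu
  have h3 : |r * a| ≤ ‖u‖ := by
    rw [abs_mul]
    exact (mul_le_of_le_one_right (abs_nonneg _) ha).trans hwu
  have h4 : |a * b * c| ≤ ‖u‖ := by
    rw [abs_mul, abs_mul]
    exact (mul_le_of_le_one_left (abs_nonneg _) (mul_le_one₀ ha (abs_nonneg _) hb)).trans hc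
  rw [abs_le] at h1 h2 h3 h4 ⊢
  constructor <;> linarith

theorem hasDerivAt_inner_line (v z u : Plane) (t : ℝ) :
    HasDerivAt (fun t : ℝ => ⟪v, z + t • u⟫) ⟪v, u⟫ t := by
  simp only [inner_add_right, inner_smul_right]
  simpa using ((hasDerivAt_id t).mul_const ⟪v, u⟫).const_add ⟪v, z⟫

theorem hasDerivAt_sq_norm_line (ε : ℝ) (z u : Plane) (t : ℝ) :
    HasDerivAt (fun t : ℝ => ‖z + t • u‖ ^ 2 + ε ^ 2) (2 * ⟪u, z + t • u⟫) t := by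
  have h : HasDerivAt (fun t : ℝ => z + t • u) u t := by
    simpa using ((hasDerivAt_id t).smul_const u).const_add z
  have := h.norm_sq.add_const (ε ^ 2)
  rwa [real_inner_comm] at this

theorem hasDerivAt_regField_line (hε : 0 < ε) (v z u : Plane) (t : ℝ) :
    HasDerivAt (fun t : ℝ => regField ε v (z + t • u)) (regKernel ε v u (z + t • u)) t := by
  have hD := sq_norm_add_sq_pos hε (z + t • u)
  refine ((hasDerivAt_inner_line v z u t).div (hasDerivAt_sq_norm_line ε z u t)
    hD.ne').congr_deriv ?_
  rw [regKernel]
  field_simp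

theorem hasDerivAt_regKernel_line (hε : 0 < ε) (v w z u : Plane) (t : ℝ) :
    HasDerivAt (fun t : ℝ => regKernel ε v w (z + t • u))
      (regKernelDeriv ε v w u (z + t • u)) t := by
  have hD := sq_norm_add_sq_pos hε (z + t • u)
  have hd := hasDerivAt_sq_norm_line ε z u t
  refine (((hasDerivAt_const t ⟪v, w⟫).div hd hD.ne').sub
    ((((hasDerivAt_inner_line v z u t).mul (hasDerivAt_inner_line w z u t)).const_mul 2).div
      (hd.pow 2) (pow_pos hD 2).ne')).congr_deriv ?_
  rw [regKernelDeriv]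
  simp only [Pi.pow_apply, Pi.mul_apply]
  field_simp
  ring

theorem hasLineDerivAt_regField (hε : 0 < ε) (v y u z : Plane) :
    HasLineDerivAt ℝ (fun x => regField ε v (x - y)) (regKernel ε v u (z - y)) z u := by
  have := hasDerivAt_regField_line hε v (z - y) u 0
  simp only [zero_smul, add_zero] at this
  refine this.congr_of_eventuallyEq (Eventually.of_forall fun t => ?_)
  simp only [add_sub_right_comm]

theorem hasLineDerivAt_regKernel (hε : 0 < ε) (v w y u z : Plane) :
    HasLineDerivAt ℝ (fun x => regKernel ε v w (x - y)) (regKernelDeriv ε v w u (z - y)) z u := by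
  have := hasDerivAt_regKernel_line hε v w (z - y) u 0
  simp only [zero_smul, add_zero] at this
  refine this.congr_of_eventuallyEq (Eventually.of_forall fun t => ?_)
  simp only [add_sub_right_comm]

theorem integrable_invMod_pow_three (hε : 0 < ε) : Integrable (fun z => invMod ε z ^ 3) := by
  have h := integrable_rpow_neg_one_add_norm_sq (E := Plane) (μ := volume) (r := 3)
    (by simp [Plane]; norm_num)
  have h2 := (h.comp_smul (R := ε⁻¹) (by positivity)).const_mul (ε⁻¹ ^ 3)
  refine h2.congr (Eventually.of_forall fun z => ?_)
  have hD := sq_norm_add_sq_pos hε z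
  have e1 : 1 + ‖ε⁻¹ • z‖ ^ 2 = (‖z‖ ^ 2 + ε ^ 2) / ε ^ 2 := by
    rw [norm_smul, Real.norm_of_nonneg (by positivity)]
    field_simp
    ring
  have e2 : ∀ a : ℝ, 0 < a → a ^ (-(3 : ℝ) / 2) = (√a)⁻¹ ^ 3 := by
    intro a ha
    rw [Real.sqrt_eq_rpow, ← Real.rpow_neg ha.le, ← Real.rpow_natCast, ← Real.rpow_mul ha.le]
    norm_num
  simp only [e1]
  rw [e2 _ (by positivity), Real.sqrt_div hD.le, Real.sqrt_sq hε.le, invMod]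
  have := Real.sqrt_pos.2 hD
  field_simp

theorem integrable_invMod_pow_four (hε : 0 < ε) : Integrable (fun z => invMod ε z ^ 4) := by
  refine ((integrable_invMod_pow_three hε).const_mul ε⁻¹).mono'
    ((continuous_invMod hε).pow 4).aestronglyMeasurable (Eventually.of_forall fun z => ?_)
  have := invMod_pos hε z
  rw [Real.norm_of_nonneg (by positivity), pow_succ, mul_comm]
  gcongr
  exact invMod_le hε z

end Regularised

section Hormander

variable {ε : ℝ}

theorem abs_regKernel_sub_le (hε : 0 < ε) {v w : Plane} (hv : ‖v‖ ≤ 1) (hw : ‖w‖ ≤ 1)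
    {r : ℝ} (hr : 0 < r) {x y : Plane} (hy : ‖y‖ ≤ r) (hx : 2 * r ≤ ‖x‖) :
    |regKernel ε v w (x - y) - regKernel ε v w x| ≤ 896 * (r * (r + ‖x‖)⁻¹ ^ 3) := by
  have h := norm_image_sub_le_of_norm_deriv_le_segment_01'
    (f := fun t : ℝ => regKernel ε v w (x + t • -y))
    (f' := fun t : ℝ => regKernelDeriv ε v w (-y) (x + t • -y))
    (C := 896 * (r * (r + ‖x‖)⁻¹ ^ 3))
    (fun t _ => (hasDerivAt_regKernel_line hε v w x (-y) t).hasDerivWithinAt) ?_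
  · simpa [sub_eq_add_neg] using h
  · intro t ht
    refine (abs_regKernelDeriv_le hε hv hw _ _).trans ?_
    set z := x + t • -y
    have hz : (r + ‖x‖) / 4 ≤ ‖z‖ := by
      have h1 : ‖x‖ ≤ ‖z‖ + ‖t • y‖ := by
        have : x = z + t • y := by simp [z]
        calc ‖x‖ = ‖z + t • y‖ := by rw [← this]
          _ ≤ _ := norm_add_le _ _
      have h2 : ‖t • y‖ ≤ r := by
        rw [norm_smul, Real.norm_of_nonneg ht.1]
        exact (mul_le_of_le_one_left (norm_nonneg _) ht.2.le).trans hy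
      linarith
    have hz0 : 0 < (r + ‖x‖) / 4 := by positivity
    have h3 : invMod ε z ≤ 4 * (r + ‖x‖)⁻¹ := by
      calc invMod ε z ≤ ‖z‖⁻¹ := by
            rw [← one_div, le_div_iff₀ (hz0.trans_le hz), mul_comm]
            exact norm_mul_invMod_le hε z
        _ ≤ ((r + ‖x‖) / 4)⁻¹ := by gcongr
        _ = _ := by rw [inv_div, div_eq_mul_inv]
    have h4 := invMod_pos hε z
    calc 14 * ‖-y‖ * invMod ε z ^ 3 ≤ 14 * r * (4 * (r + ‖x‖)⁻¹) ^ 3 := by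
          rw [norm_neg]
          gcongr
      _ = _ := by ring

theorem integrable_inv_one_add_norm_pow_three :
    Integrable (fun x : Plane => (1 + ‖x‖)⁻¹ ^ 3) := by
  have h := integrable_one_add_norm (E := Plane) (μ := volume) (r := 3)
    (by simp [Plane]; norm_num)
  refine h.congr (Eventually.of_forall fun x => ?_)
  have : (0 : ℝ) ≤ 1 + ‖x‖ := by positivity
  simp only [Real.rpow_neg this, inv_pow]
  norm_cast

theorem inv_add_norm_eq {r : ℝ} (hr : 0 < r) (x : Plane) :
    r * (r + ‖x‖)⁻¹ ^ 3 = r⁻¹ ^ 2 * (1 + ‖r⁻¹ • x‖)⁻¹ ^ 3 := by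
  rw [norm_smul, Real.norm_of_nonneg (by positivity)]
  have : 1 + r⁻¹ * ‖x‖ = (r + ‖x‖) / r := by field_simp
  rw [this]
  have : 0 < r + ‖x‖ := by positivity
  field_simp

theorem lintegral_inv_add_norm {r : ℝ} (hr : 0 < r) :
    ∫⁻ x : Plane, ENNReal.ofReal (896 * (r * (r + ‖x‖)⁻¹ ^ 3))
      = ENNReal.ofReal (896 * ∫ x : Plane, (1 + ‖x‖)⁻¹ ^ 3) := by
  have hi := integrable_inv_one_add_norm_pow_three.comp_smul (R := r⁻¹) (by positivity)
  rw [← ofReal_integral_eq_lintegral_ofReal]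
  · rw [integral_const_mul]
    simp only [inv_add_norm_eq hr]
    rw [integral_const_mul, Measure.integral_comp_smul volume
      (fun x : Plane => (1 + ‖x‖)⁻¹ ^ 3) r⁻¹]
    have : Module.finrank ℝ Plane = 2 := by simp [Plane]
    rw [this, abs_of_nonneg (by positivity), smul_eq_mul]
    congr 2
    field_simp
  · simp only [inv_add_norm_eq hr]
    exact (hi.const_mul _).const_mul _
  · exact Eventually.of_forall fun x => by positivity

theorem lintegral_regKernel_sub_le (hε : 0 < ε) {v w : Plane} (hv : ‖v‖ ≤ 1) (hw : ‖w‖ ≤ 1)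
    {r : ℝ} (hr : 0 < r) {y : Plane} (hy : ‖y‖ ≤ r) :
    ∫⁻ x in (Metric.closedBall 0 (2 * r))ᶜ, ‖regKernel ε v w (x - y) - regKernel ε v w x‖ₑ
      ≤ ENNReal.ofReal (896 * ∫ x : Plane, (1 + ‖x‖)⁻¹ ^ 3) := by
  rw [← lintegral_inv_add_norm hr]
  refine (setLIntegral_mono' Metric.isClosed_closedBall.measurableSet.compl fun x hx => ?_).trans
    (setLIntegral_le_lintegral _ _)
  rw [Real.enorm_eq_ofReal_abs]
  refine ENNReal.ofReal_le_ofReal (abs_regKernel_sub_le hε hv hw hr hy ?_)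
  simp only [mem_compl_iff, Metric.mem_closedBall, dist_zero_right, not_le] at hx
  exact hx.le

end Hormander

section Correlation

/-- A kernel dominated by an integrable function, tested against an integrable function of two
variables, in a translate determined by `π`. -/
theorem integrable_translate_mul {g : Plane → ℝ} (hg : Integrable g) (hgm : Continuous g)
    {π : Plane × Plane → Plane} (hπ : Continuous π) {F : Plane × Plane → ℝ} (hF : Integrable F) :
    Integrable (fun p : Plane × (Plane × Plane) => g (p.1 - π p.2) * F p.2) := by
  rw [Measure.volume_eq_prod, integrable_prod_iff']
  · refine ⟨Eventually.of_forall fun q => (hg.comp_sub_right (π q)).mul_const (F q), ?_⟩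
    simp only [norm_mul, integral_mul_const]
    have : ∀ q, ∫ x, ‖g (x - π q)‖ = ∫ x, ‖g x‖ := fun q =>
      integral_sub_right_eq_self (fun x => ‖g x‖) (π q)
    simp only [this]
    exact hF.norm.const_mul _
  · exact (Continuous.aestronglyMeasurable (by fun_prop)).mul hF.aestronglyMeasurable.comp_snd

variable {ε : ℝ} {P Q f : Plane → ℝ}

theorem integrable_correlation (hε : 0 < ε) (hP : Continuous P) (hQ : Continuous Q)
    (hPb : ∀ z, |P z| ≤ 3 * invMod ε z ^ 2) (hQb : ∀ z, |Q z| ≤ 3 * invMod ε z ^ 2)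
    (hf : Integrable f) :
    Integrable (fun p : Plane × (Plane × Plane) =>
      (P (p.1 - p.2.1) * f p.2.1) * (Q (p.1 - p.2.2) * f p.2.2)) := by
  have hF : Integrable (fun q : Plane × Plane => f q.1 * f q.2) := hf.mul_prod hf
  have hg := (integrable_invMod_pow_four hε).const_mul 9
  have hgc : Continuous (fun z => 9 * invMod ε z ^ 4) :=
    ((continuous_invMod hε).pow 4).const_mul 9
  have h1 := (integrable_translate_mul hg hgc continuous_fst hF).norm
  have h2 := (integrable_translate_mul hg hgc continuous_snd hF).norm
  refine (h1.add h2).mono' ?_ (Eventually.of_forall fun p => ?_)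
  · have : Continuous (fun p : Plane × (Plane × Plane) => P (p.1 - p.2.1) * Q (p.1 - p.2.2)) := by
      fun_prop
    have hm := this.aestronglyMeasurable (μ := volume).mul
      (hF.aestronglyMeasurable.comp_snd (μ := (volume : Measure Plane)))
    refine hm.congr (Eventually.of_forall fun p => ?_)
    simp only [Pi.mul_apply]
    ring
  · simp only [Pi.add_apply, norm_mul, Real.norm_eq_abs]
    have ha := hPb (p.1 - p.2.1)
    have hb := hQb (p.1 - p.2.2)
    have ha0 := (invMod_pos hε (p.1 - p.2.1)).le
    have hb0 := (invMod_pos hε (p.1 - p.2.2)).le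
    rw [abs_of_nonneg (pow_nonneg ha0 4), abs_of_nonneg (pow_nonneg hb0 4),
      abs_of_nonneg (by norm_num : (0 : ℝ) ≤ 9)]
    have hPQ : |P (p.1 - p.2.1)| * |Q (p.1 - p.2.2)| ≤
        9 * invMod ε (p.1 - p.2.1) ^ 4 + 9 * invMod ε (p.1 - p.2.2) ^ 4 := by
      refine (mul_le_mul ha hb (abs_nonneg _) (by positivity)).trans ?_
      nlinarith [sq_nonneg (invMod ε (p.1 - p.2.1) ^ 2 - invMod ε (p.1 - p.2.2) ^ 2),
        sq_nonneg (invMod ε (p.1 - p.2.1) ^ 2), sq_nonneg (invMod ε (p.1 - p.2.2) ^ 2)]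
    calc _ = |P (p.1 - p.2.1)| * |Q (p.1 - p.2.2)| * (|f p.2.1| * |f p.2.2|) := by ring
      _ ≤ (9 * invMod ε (p.1 - p.2.1) ^ 4 + 9 * invMod ε (p.1 - p.2.2) ^ 4)
          * (|f p.2.1| * |f p.2.2|) := by gcongr
      _ = _ := by ring

theorem kernelOp_mul_kernelOp (P Q f : Plane → ℝ) (x : Plane) :
    kernelOp P f x * kernelOp Q f x =
      ∫ q : Plane × Plane, (P (x - q.1) * f q.1) * (Q (x - q.2) * f q.2) := by
  rw [kernelOp, kernelOp, Measure.volume_eq_prod]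
  exact (integral_prod_mul (fun y => P (x - y) * f y) (fun y => Q (x - y) * f y)).symm

theorem integrable_kernelOp_mul_kernelOp (hε : 0 < ε) (hP : Continuous P) (hQ : Continuous Q)
    (hPb : ∀ z, |P z| ≤ 3 * invMod ε z ^ 2) (hQb : ∀ z, |Q z| ≤ 3 * invMod ε z ^ 2)
    (hf : Integrable f) : Integrable (fun x => kernelOp P f x * kernelOp Q f x) := by
  simp only [kernelOp_mul_kernelOp]
  exact (integrable_correlation hε hP hQ hPb hQb hf).integral_prod_left

theorem integral_kernelOp_mul_kernelOp (hε : 0 < ε) (hP : Continuous P) (hQ : Continuous Q)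
    (hPb : ∀ z, |P z| ≤ 3 * invMod ε z ^ 2) (hQb : ∀ z, |Q z| ≤ 3 * invMod ε z ^ 2)
    (hf : Integrable f) :
    ∫ x, kernelOp P f x * kernelOp Q f x =
      ∫ q : Plane × Plane, f q.1 * f q.2 * ∫ x, P (x - q.1) * Q (x - q.2) := by
  simp only [kernelOp_mul_kernelOp]
  rw [integral_integral_swap (integrable_correlation hε hP hQ hPb hQb hf)]
  refine integral_congr_ae (Eventually.of_forall fun q => ?_)
  simp only
  rw [← integral_const_mul]
  refine integral_congr_ae (Eventually.of_forall fun x => ?_)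
  simp only
  ring

end Correlation

section IntegrationByParts

variable {ε : ℝ}

theorem integrable_mul_of_le_invMod (hε : 0 < ε) {F G : Plane → ℝ} (hF : Continuous F)
    (hG : Continuous G) {C : ℝ} {m n : ℕ} (y y' : Plane)
    (hmn : m + n = 3 ∨ m + n = 4)
    (h : ∀ x, |F x * G x| ≤ C * (invMod ε (x - y) ^ m * invMod ε (x - y') ^ n)) :
    Integrable (fun x => F x * G x) := by
  have key : ∀ k, Integrable (fun z => invMod ε z ^ k) → m + n = k →
      Integrable (fun x => F x * G x) := by
    intro k hk hmnk
    have h1 := ((hk.comp_sub_right y).add (hk.comp_sub_right y')).const_mul |C|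
    refine h1.mono' (hF.mul hG).aestronglyMeasurable (Eventually.of_forall fun x => ?_)
    have ha := (invMod_pos hε (x - y)).le
    have hb := (invMod_pos hε (x - y')).le
    refine (h x).trans ?_
    simp only [Pi.add_apply]
    have hle : invMod ε (x - y) ^ m * invMod ε (x - y') ^ n ≤
        invMod ε (x - y) ^ k + invMod ε (x - y') ^ k := by
      rw [← hmnk, pow_add, pow_add]
      rcases le_total (invMod ε (x - y)) (invMod ε (x - y')) with hab | hab
      · refine le_add_of_nonneg_of_le (by positivity) ?_
        gcongr
      · refine le_add_of_le_of_nonneg ?_ (by positivity)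
        gcongr
    exact mul_le_mul (le_abs_self C) hle (by positivity) (abs_nonneg C)
  rcases hmn with h3 | h4
  · exact key 3 (integrable_invMod_pow_three hε) h3
  · exact key 4 (integrable_invMod_pow_four hε) h4

/-- Integration by parts for the correlation of two regularised kernels. -/
theorem integral_regKernel_mul_regKernel (hε : 0 < ε) {a u v w : Plane} (ha : ‖a‖ ≤ 1)
    (hu : ‖u‖ ≤ 1) (hv : ‖v‖ ≤ 1) (hw : ‖w‖ ≤ 1) (y y' : Plane) :
    ∫ x, regKernel ε a u (x - y) * regKernel ε v w (x - y') =
      -∫ x, regField ε a (x - y) * regKernelDeriv ε v w u (x - y') := by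
  have c0 : Continuous (fun x => regField ε a (x - y)) :=
    (continuous_regField hε a).comp (by fun_prop)
  have c1 : Continuous (fun x => regKernel ε a u (x - y)) :=
    (continuous_regKernel hε a u).comp (by fun_prop)
  have c2 : Continuous (fun x => regKernel ε v w (x - y')) :=
    (continuous_regKernel hε v w).comp (by fun_prop)
  have c3 : Continuous (fun x => regKernelDeriv ε v w u (x - y')) :=
    (continuous_regKernelDeriv hε v w u).comp (by fun_prop)
  have b0 := fun x => abs_regField_le hε ha (x - y)
  have b1 := fun x => abs_regKernel_le hε ha hu (x - y)
  have b2 := fun x => abs_regKernel_le hε hv hw (x - y')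
  have b3 : ∀ x, |regKernelDeriv ε v w u (x - y')| ≤ 14 * invMod ε (x - y') ^ 3 := fun x => by
    have := (invMod_pos hε (x - y')).le
    refine (abs_regKernelDeriv_le hε hv hw u (x - y')).trans ?_
    gcongr
    linarith
  have h := integral_bilinear_hasLineDerivAt_right_eq_neg_left_of_integrable
    (μ := (volume : Measure Plane)) (B := ContinuousLinearMap.mul ℝ ℝ) (v := u)
    (f := fun x => regField ε a (x - y)) (f' := fun x => regKernel ε a u (x - y))
    (g := fun x => regKernel ε v w (x - y')) (g' := fun x => regKernelDeriv ε v w u (x - y'))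
    ?_ ?_ ?_ (fun x _ => hasLineDerivAt_regField hε a y u x)
    (fun x _ => hasLineDerivAt_regKernel hε v w y' u x)
  · exact (neg_eq_iff_eq_neg.2 h).symm
  · refine integrable_mul_of_le_invMod hε c1 c2 (C := 9) (m := 2) (n := 2) y y' (.inr rfl)
      fun x => ?_
    rw [abs_mul]
    refine (mul_le_mul (b1 x) (b2 x) (abs_nonneg _) (by positivity)).trans_eq (by ring)
  · refine integrable_mul_of_le_invMod hε c0 c3 (C := 14) (m := 1) (n := 3) y y' (.inr rfl)
      fun x => ?_
    rw [abs_mul]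
    refine (mul_le_mul (b0 x) (b3 x) (abs_nonneg _) ((abs_nonneg _).trans (b0 x))).trans_eq
      (by ring)
  · refine integrable_mul_of_le_invMod hε c0 c2 (C := 3) (m := 1) (n := 2) y y' (.inl rfl)
      fun x => ?_
    rw [abs_mul]
    refine (mul_le_mul (b0 x) (b2 x) (abs_nonneg _) ((abs_nonneg _).trans (b0 x))).trans_eq
      (by ring)

theorem integral_regKernel_mul_self (hε : 0 < ε) {v w : Plane} (hv : ‖v‖ ≤ 1) (hw : ‖w‖ ≤ 1)
    (y y' : Plane) :
    ∫ x, regKernel ε v w (x - y) * regKernel ε v w (x - y') =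
      ∫ x, regKernel ε v v (x - y) * regKernel ε w w (x - y') := by
  rw [integral_regKernel_mul_regKernel hε hv hw hv hw,
    integral_regKernel_mul_regKernel hε hv hv hw hw]
  simp only [regKernelDeriv_swap v w]

theorem integral_sq_kernelOp_regKernel (hε : 0 < ε) {v w : Plane} (hv : ‖v‖ ≤ 1) (hw : ‖w‖ ≤ 1)
    {f : Plane → ℝ} (hf : Integrable f) :
    ∫ x, kernelOp (regKernel ε v w) f x * kernelOp (regKernel ε v w) f x =
      ∫ x, kernelOp (regKernel ε v v) f x * kernelOp (regKernel ε w w) f x := by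
  have c := fun a b : Plane => continuous_regKernel hε a b
  rw [integral_kernelOp_mul_kernelOp hε (c v w) (c v w) (abs_regKernel_le hε hv hw)
      (abs_regKernel_le hε hv hw) hf,
    integral_kernelOp_mul_kernelOp hε (c v v) (c w w) (abs_regKernel_le hε hv hv)
      (abs_regKernel_le hε hw hw) hf]
  simp only [integral_regKernel_mul_self hε hv hw]

end IntegrationByParts

section SquareFunction

theorem sq_lintegral_mul_le {φ f : Plane → ℝ≥0∞} (hφ : AEMeasurable φ) (hf : AEMeasurable f) :
    (∫⁻ y, φ y * f y) ^ 2 ≤ (∫⁻ y, φ y) * ∫⁻ y, φ y * f y ^ 2 := by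
  have h := ENNReal.lintegral_mul_le_Lp_mul_Lq volume Real.HolderConjugate.two_two
    (f := fun y => φ y ^ (1 / 2 : ℝ)) (g := fun y => φ y ^ (1 / 2 : ℝ) * f y)
    (hφ.pow_const _) ((hφ.pow_const _).mul hf)
  have e1 : ∀ a : ℝ≥0∞, a ^ (1 / 2 : ℝ) * a ^ (1 / 2 : ℝ) = a := fun a => by
    rw [← ENNReal.rpow_add_of_nonneg _ _ (by norm_num) (by norm_num)]
    norm_num
  have e2 : ∀ a : ℝ≥0∞, (a ^ (1 / 2 : ℝ)) ^ (2 : ℝ) = a := fun a => by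
    rw [← ENNReal.rpow_mul]
    norm_num
  have e3 : ∀ a : ℝ≥0∞, (a ^ (1 / 2 : ℝ)) ^ 2 = a := fun a => by
    rw [sq, e1]
  simp only [Pi.mul_apply, ← mul_assoc, e1, ENNReal.mul_rpow_of_nonneg _ _ zero_le_two, e2] at h
  refine (pow_le_pow_left₀ zero_le h 2).trans_eq ?_
  rw [mul_pow, e3, e3]
  simp only [ENNReal.rpow_two]

/-- Young's inequality `‖φ * f‖₂ ≤ ‖φ‖₁ ‖f‖₂`. -/
theorem lintegral_sq_kernelOp_le {φ f : Plane → ℝ} (hφ : Continuous φ)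
    (hf : AEStronglyMeasurable f) :
    ∫⁻ x, ‖kernelOp φ f x‖ₑ ^ 2 ≤ (∫⁻ z, ‖φ z‖ₑ) ^ 2 * ∫⁻ y, ‖f y‖ₑ ^ 2 := by
  have hm : Measurable fun z => ‖φ z‖ₑ := hφ.measurable.enorm
  have h1 : ∀ x, ‖kernelOp φ f x‖ₑ ^ 2 ≤
      (∫⁻ z, ‖φ z‖ₑ) * ∫⁻ y, ‖φ (x - y)‖ₑ * ‖f y‖ₑ ^ 2 := by
    intro x
    have h2 : ‖kernelOp φ f x‖ₑ ≤ ∫⁻ y, ‖φ (x - y)‖ₑ * ‖f y‖ₑ := by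
      refine (enorm_integral_le_lintegral_enorm _).trans_eq ?_
      simp only [enorm_mul]
    refine (pow_le_pow_left₀ zero_le h2 2).trans ((sq_lintegral_mul_le ?_ hf.enorm).trans_eq ?_)
    · exact (hm.comp (measurable_const.sub measurable_id)).aemeasurable
    · rw [lintegral_sub_left_eq_self (fun z => ‖φ z‖ₑ) x]
  refine (lintegral_mono h1).trans ?_
  have hjoint : AEMeasurable (fun p : Plane × Plane => ‖φ (p.1 - p.2)‖ₑ * ‖f p.2‖ₑ ^ 2)
      (volume.prod volume) :=
    (hm.comp (measurable_fst.sub measurable_snd)).aemeasurable.mul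
      ((hf.enorm.comp_snd).pow_const 2)
  have hmeas : AEMeasurable fun x => ∫⁻ y, ‖φ (x - y)‖ₑ * ‖f y‖ₑ ^ 2 :=
    hjoint.lintegral_prod_right'
  rw [lintegral_const_mul'' _ hmeas, lintegral_lintegral_swap hjoint, sq, mul_assoc]
  refine mul_le_mul_right (le_of_eq ?_) _
  have : ∀ y, ∫⁻ x, ‖φ (x - y)‖ₑ * ‖f y‖ₑ ^ 2 = (∫⁻ z, ‖φ z‖ₑ) * ‖f y‖ₑ ^ 2 := by
    intro y
    have hy : Measurable fun x => ‖φ (x - y)‖ₑ := hm.comp (measurable_id.sub measurable_const)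
    rw [lintegral_mul_const'' _ hy.aemeasurable, lintegral_sub_right_eq_self (fun z => ‖φ z‖ₑ) y]
  simp only [this]
  rw [lintegral_const_mul'' _ (hf.enorm.pow_const 2)]

end SquareFunction

section RegularisedKernel

variable {ε : ℝ}

/-- The standard basis of the plane. -/
def planeBasis (i : Fin 2) : Plane := EuclideanSpace.single i 1

theorem norm_planeBasis (i : Fin 2) : ‖planeBasis i‖ ≤ 1 := by
  simp [planeBasis]

theorem inner_planeBasis (i : Fin 2) (z : Plane) : ⟪planeBasis i, z⟫ = z i := by
  simp [planeBasis, EuclideanSpace.inner_single_left]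

theorem regKernel_add_regKernel (hε : 0 < ε) (z : Plane) :
    regKernel ε (planeBasis 0) (planeBasis 0) z + regKernel ε (planeBasis 1) (planeBasis 1) z
      = 2 * ε ^ 2 * invMod ε z ^ 4 := by
  have hD := sq_norm_add_sq_pos hε z
  have h4 : invMod ε z ^ 4 = ((‖z‖ ^ 2 + ε ^ 2)⁻¹) ^ 2 := by
    rw [← sq_invMod hε]
    ring
  have hz : ‖z‖ ^ 2 = z 0 ^ 2 + z 1 ^ 2 := by
    rw [EuclideanSpace.norm_sq_eq]
    simp
  have e0 : planeBasis 0 0 = 1 := by simp [planeBasis]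
  have e1 : planeBasis 1 1 = 1 := by simp [planeBasis]
  rw [h4]
  simp only [regKernel, inner_planeBasis, e0, e1]
  field_simp
  rw [hz]
  ring

theorem invMod_smul (hε : 0 < ε) (z : Plane) : invMod ε z = ε⁻¹ * invMod 1 (ε⁻¹ • z) := by
  have hD := sq_norm_add_sq_pos hε z
  have e1 : ‖ε⁻¹ • z‖ ^ 2 + 1 ^ 2 = (‖z‖ ^ 2 + ε ^ 2) / ε ^ 2 := by
    rw [norm_smul, Real.norm_of_nonneg (by positivity)]
    field_simp
  rw [invMod, invMod, e1, Real.sqrt_div hD.le, Real.sqrt_sq hε.le]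
  have := Real.sqrt_pos.2 hD
  field_simp

theorem lintegral_sq_mul_invMod (hε : 0 < ε) :
    ∫⁻ z, ‖2 * ε ^ 2 * invMod ε z ^ 4‖ₑ = ENNReal.ofReal (2 * ∫ z, invMod 1 z ^ 4) := by
  have h0 : ∀ z, 0 ≤ 2 * ε ^ 2 * invMod ε z ^ 4 := fun z => by
    have := invMod_pos hε z
    positivity
  rw [← ofReal_integral_norm_eq_lintegral_enorm ((integrable_invMod_pow_four hε).const_mul _)]
  congr 1
  simp only [Real.norm_of_nonneg (h0 _)]
  have e : ∀ z, 2 * ε ^ 2 * invMod ε z ^ 4 = 2 * (ε⁻¹ ^ 2 * invMod 1 (ε⁻¹ • z) ^ 4) := by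
    intro z
    rw [invMod_smul hε]
    field_simp
  simp only [e]
  rw [integral_const_mul, integral_const_mul,
    Measure.integral_comp_smul volume (fun z : Plane => invMod 1 z ^ 4) ε⁻¹]
  have : Module.finrank ℝ Plane = 2 := by simp [Plane]
  rw [this, abs_of_nonneg (by positivity), smul_eq_mul]
  field_simp

theorem integrable_regKernel_sub_mul (hε : 0 < ε) {v w : Plane} (hv : ‖v‖ ≤ 1) (hw : ‖w‖ ≤ 1)
    {f : Plane → ℝ} (hf : Integrable f) (x : Plane) :
    Integrable (fun y => regKernel ε v w (x - y) * f y) := by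
  refine hf.bdd_mul (c := 3 * ε⁻¹ ^ 2) ?_ (Eventually.of_forall fun y => ?_)
  · exact ((continuous_regKernel hε v w).comp (by fun_prop)).aestronglyMeasurable
  · refine (abs_regKernel_le hε hv hw _).trans ?_
    have := invMod_pos hε (x - y)
    have := invMod_le hε (x - y)
    gcongr

theorem kernelOp_sq_mul_invMod (hε : 0 < ε) {f : Plane → ℝ} (hf : Integrable f) (x : Plane) :
    kernelOp (fun z => 2 * ε ^ 2 * invMod ε z ^ 4) f x =
      kernelOp (regKernel ε (planeBasis 0) (planeBasis 0)) f x
        + kernelOp (regKernel ε (planeBasis 1) (planeBasis 1)) f x := by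
  simp only [kernelOp, ← regKernel_add_regKernel hε, add_mul]
  exact integral_add
    (integrable_regKernel_sub_mul hε (norm_planeBasis 0) (norm_planeBasis 0) hf x)
    (integrable_regKernel_sub_mul hε (norm_planeBasis 1) (norm_planeBasis 1) hf x)

/-- The energy identity behind the `L²` bound. -/
theorem integral_sq_kernelOp_add (hε : 0 < ε) {f : Plane → ℝ} (hf : Integrable f) :
    (∫ x, kernelOp (regKernel ε (planeBasis 0) (planeBasis 0)) f x ^ 2)
      + (∫ x, kernelOp (regKernel ε (planeBasis 1) (planeBasis 1)) f x ^ 2)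
      + 2 * (∫ x, kernelOp (regKernel ε (planeBasis 0) (planeBasis 1)) f x ^ 2)
    = ∫ x, kernelOp (fun z => 2 * ε ^ 2 * invMod ε z ^ 4) f x ^ 2 := by
  have n0 := norm_planeBasis 0
  have n1 := norm_planeBasis 1
  have i := fun a b c d : Fin 2 => integrable_kernelOp_mul_kernelOp hε
    (continuous_regKernel hε (planeBasis a) (planeBasis b))
    (continuous_regKernel hε (planeBasis c) (planeBasis d))
    (abs_regKernel_le hε (norm_planeBasis a) (norm_planeBasis b))
    (abs_regKernel_le hε (norm_planeBasis c) (norm_planeBasis d)) hf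
  have h := integral_sq_kernelOp_regKernel hε n0 n1 hf
  simp only [kernelOp_sq_mul_invMod hε hf]
  simp only [sq]
  rw [h, ← integral_const_mul, ← integral_add (i 0 0 0 0) (i 1 1 1 1),
    ← integral_add (f := fun x => _ + _) ((i 0 0 0 0).add (i 1 1 1 1)) ((i 0 0 1 1).const_mul 2)]
  refine integral_congr_ae (Eventually.of_forall fun x => ?_)
  simp only
  ring

theorem lintegral_sq_kernelOp_regKernel_le (hε : 0 < ε) {f : Plane → ℝ} (hf : Integrable f)
    (i j : Fin 2) :
    ∫⁻ x, ‖kernelOp (regKernel ε (planeBasis i) (planeBasis j)) f x‖ₑ ^ 2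
      ≤ ENNReal.ofReal (2 * ∫ z, invMod 1 z ^ 4) ^ 2 * ∫⁻ x, ‖f x‖ₑ ^ 2 := by
  set φ : Plane → ℝ := fun z => 2 * ε ^ 2 * invMod ε z ^ 4 with hφ
  have hφc : Continuous φ := ((continuous_invMod hε).pow 4).const_mul _
  have hY := lintegral_sq_kernelOp_le hφc hf.aestronglyMeasurable
  rw [lintegral_sq_mul_invMod hε] at hY
  refine le_trans ?_ hY
  have I := fun a b c d : Fin 2 => integrable_kernelOp_mul_kernelOp hε
    (continuous_regKernel hε (planeBasis a) (planeBasis b))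
    (continuous_regKernel hε (planeBasis c) (planeBasis d))
    (abs_regKernel_le hε (norm_planeBasis a) (norm_planeBasis b))
    (abs_regKernel_le hε (norm_planeBasis c) (norm_planeBasis d)) hf
  have S : ∀ a b : Fin 2, Integrable fun x =>
      kernelOp (regKernel ε (planeBasis a) (planeBasis b)) f x ^ 2 := fun a b => by
    simpa only [sq] using I a b a b
  have conv : ∀ K : Plane → ℝ, ∫⁻ x, ‖kernelOp K f x‖ₑ ^ 2 =
      ∫⁻ x, ENNReal.ofReal (kernelOp K f x ^ 2) := fun K => by
    refine lintegral_congr fun x => ?_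
    rw [Real.enorm_eq_ofReal_abs, ← ENNReal.ofReal_pow (abs_nonneg _), sq_abs]
  have hE := integral_sq_kernelOp_add hε hf
  have hφi : Integrable fun x => kernelOp φ f x ^ 2 := by
    simp only [hφ, kernelOp_sq_mul_invMod hε hf]
    simp only [add_sq, mul_assoc]
    exact ((S 0 0).add ((I 0 0 1 1).const_mul 2)).add (S 1 1)
  rw [conv, conv, ← ofReal_integral_eq_lintegral_ofReal (S i j)
      (Eventually.of_forall fun x => sq_nonneg _),
    ← ofReal_integral_eq_lintegral_ofReal hφi (Eventually.of_forall fun x => sq_nonneg _)]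
  refine ENNReal.ofReal_le_ofReal ?_
  have p : ∀ a b : Fin 2,
      0 ≤ ∫ x, kernelOp (regKernel ε (planeBasis a) (planeBasis b)) f x ^ 2 :=
    fun a b => integral_nonneg fun x => sq_nonneg _
  have p00 := p 0 0
  have p11 := p 1 1
  have p01 := p 0 1
  have hcomm : regKernel ε (planeBasis 1) (planeBasis 0) =
      regKernel ε (planeBasis 0) (planeBasis 1) := funext fun z => regKernel_comm _ _ z
  fin_cases i <;> fin_cases j <;> simp only [Fin.zero_eta, Fin.mk_one, Fin.isValue, hcomm] <;>
    linarith

theorem exists_isCalderonZygmundKernel_regKernel : ∃ A H : NNReal, ∀ ε : ℝ, 0 < ε →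
    ∀ i j : Fin 2, IsCalderonZygmundKernel (regKernel ε (planeBasis i) (planeBasis j)) A H := by
  refine ⟨(2 * ∫ z, invMod 1 z ^ 4).toNNReal ^ 2,
    (896 * ∫ x : Plane, (1 + ‖x‖)⁻¹ ^ 3).toNNReal, fun ε hε i j => ⟨?_, ?_, ?_, ?_, ?_⟩⟩
  · exact continuous_regKernel hε _ _
  · refine ⟨3 * ε⁻¹ ^ 2, fun z =>
      (abs_regKernel_le hε (norm_planeBasis i) (norm_planeBasis j) z).trans ?_⟩
    have := invMod_pos hε z
    have := invMod_le hε z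
    gcongr
  · exact regKernel_neg _ _
  · intro f hf _
    exact lintegral_sq_kernelOp_regKernel_le hε hf i j
  · intro r hr y hy
    exact lintegral_regKernel_sub_le hε (norm_planeBasis i) (norm_planeBasis j) hr hy

end RegularisedKernel

section Gradient

theorem abs_regField_zero_le {v : Plane} (hv : ‖v‖ ≤ 1) (z : Plane) :
    |regField 0 v z| ≤ ‖z‖⁻¹ := by
  rcases eq_or_ne z 0 with rfl | hz
  · simp [regField]
  have hz' : 0 < ‖z‖ := norm_pos_iff.2 hz
  rw [regField, abs_div, zero_pow two_ne_zero, add_zero, abs_of_pos (pow_pos hz' 2),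
    div_le_iff₀ (pow_pos hz' 2)]
  refine (abs_real_inner_le_norm v z).trans ?_
  rw [sq, inv_mul_cancel_left₀ hz'.ne']
  exact mul_le_of_le_one_left hz'.le hv

theorem abs_regField_le_abs_regField_zero (ε : ℝ) (v z : Plane) :
    |regField ε v z| ≤ |regField 0 v z| := by
  rcases eq_or_ne z 0 with rfl | hz
  · simp [regField]
  have hz' : 0 < ‖z‖ := norm_pos_iff.2 hz
  rw [regField, regField, abs_div, abs_div, zero_pow two_ne_zero, add_zero,
    abs_of_pos (pow_pos hz' 2), abs_of_pos (by positivity : 0 < ‖z‖ ^ 2 + ε ^ 2)]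
  exact div_le_div_of_nonneg_left (abs_nonneg _) (pow_pos hz' 2)
    (le_add_of_nonneg_right (sq_nonneg ε))

theorem tendsto_regField (v z : Plane) {ε : ℕ → ℝ} (hε : Tendsto ε atTop (𝓝 0)) :
    Tendsto (fun n => regField (ε n) v z) atTop (𝓝 (regField 0 v z)) := by
  rcases eq_or_ne z 0 with rfl | hz
  · simp [regField]
  have hz' : 0 < ‖z‖ := norm_pos_iff.2 hz
  unfold regField
  exact tendsto_const_nhds.div ((hε.pow 2).const_add _) (by positivity)

theorem measurable_regField (ε : ℝ) (v : Plane) : Measurable (regField ε v) := by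
  unfold regField
  fun_prop

theorem locallyIntegrable_regField_zero {v : Plane} (hv : ‖v‖ ≤ 1) :
    LocallyIntegrable (regField 0 v) := by
  refine locallyIntegrable_of_norm_le_rpow (C := 1) (α := 1) (by simp [Plane]) (by simp [Plane])
    (Eventually.of_forall fun z => ?_) (measurable_regField 0 v).aestronglyMeasurable
  rw [one_mul, Real.rpow_neg_one]
  exact abs_regField_zero_le hv z

theorem integrable_regField_zero_mul {v : Plane} (hv : ‖v‖ ≤ 1) {g : Plane → ℝ}
    (hg : Continuous g) (hgc : HasCompactSupport g) (x : Plane) :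
    Integrable fun y => regField 0 v (x - y) * g y :=
  (hgc.convolutionExists_right (ContinuousLinearMap.mul ℝ ℝ)
    (locallyIntegrable_regField_zero hv) hg x).integrable_swap

theorem kernelOp_eq_convolution (K g : Plane → ℝ) :
    kernelOp K g = convolution K g (ContinuousLinearMap.mul ℝ ℝ) volume := by
  funext x
  rw [convolution_eq_swap]
  rfl

theorem hasFDerivAt_kernelOp_regField_zero {v : Plane} (hv : ‖v‖ ≤ 1) {ω : Plane → ℝ}
    (hω : ContDiff ℝ 1 ω) (hωc : HasCompactSupport ω) (x : Plane) :
    ∃ L : Plane →L[ℝ] ℝ, HasFDerivAt (kernelOp (regField 0 v) ω) L x ∧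
      ∀ u, L u = kernelOp (regField 0 v) (fun y => fderiv ℝ ω y u) x := by
  rw [kernelOp_eq_convolution]
  refine ⟨_, hωc.hasFDerivAt_convolution_right _ (locallyIntegrable_regField_zero hv) hω x,
    fun u => ?_⟩
  rw [kernelOp_eq_convolution, convolution_precompR_apply _ (locallyIntegrable_regField_zero hv)
    (hωc.fderiv ℝ) (hω.continuous_fderiv one_ne_zero)]

theorem kernelOp_regField_fderiv {ε : ℝ} (hε : 0 < ε) (v u : Plane) {ω : Plane → ℝ}
    (hω : ContDiff ℝ 1 ω) (hωc : HasCompactSupport ω) (x : Plane) :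
    kernelOp (regField ε v) (fun y => fderiv ℝ ω y u) x = kernelOp (regKernel ε v u) ω x := by
  have hneg : ∀ y, regField ε v (x - y) = -regField ε v (y - x) := fun y => by
    rw [regField, regField, norm_sub_rev, ← neg_sub, inner_neg_right, neg_div]
  have c0 : Continuous fun y => regField ε v (x - y) :=
    (continuous_regField hε v).comp (by fun_prop)
  have c1 : Continuous fun y => regKernel ε v u (y - x) :=
    (continuous_regKernel hε v u).comp (by fun_prop)
  have c2 : Continuous fun y => fderiv ℝ ω y u :=
    (hω.continuous_fderiv one_ne_zero).clm_apply continuous_const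
  have h := integral_bilinear_hasLineDerivAt_right_eq_neg_left_of_integrable
    (μ := (volume : Measure Plane)) (B := ContinuousLinearMap.mul ℝ ℝ) (v := u)
    (f := fun y => regField ε v (x - y)) (f' := fun y => -regKernel ε v u (y - x))
    (g := ω) (g' := fun y => fderiv ℝ ω y u)
    ((c1.neg.mul hω.continuous).integrable_of_hasCompactSupport hωc.mul_left)
    ((c0.mul c2).integrable_of_hasCompactSupport (hωc.fderiv_apply ℝ u).mul_left)
    ((c0.mul hω.continuous).integrable_of_hasCompactSupport hωc.mul_left)
    (fun y _ => ?_)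
    (fun y _ => ((hω.differentiable one_ne_zero) y).hasFDerivAt.hasLineDerivAt u)
  · refine h.trans ?_
    rw [← integral_neg]
    refine integral_congr_ae (Eventually.of_forall fun y => ?_)
    have : regKernel ε v u (x - y) = regKernel ε v u (y - x) := by
      rw [← neg_sub, regKernel_neg]
    simp [this]
  · simp only [hneg]
    exact HasDerivAt.neg (hasLineDerivAt_regField hε v x u y)

theorem tendsto_kernelOp_regKernel {v : Plane} (hv : ‖v‖ ≤ 1) (u : Plane) {ω : Plane → ℝ}
    (hω : ContDiff ℝ 1 ω) (hωc : HasCompactSupport ω) (x : Plane) {ε : ℕ → ℝ}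
    (hε : Tendsto ε atTop (𝓝 0)) (hε0 : ∀ n, 0 < ε n) :
    Tendsto (fun n => kernelOp (regKernel (ε n) v u) ω x) atTop
      (𝓝 (kernelOp (regField 0 v) (fun y => fderiv ℝ ω y u) x)) := by
  have c2 : Continuous fun y => fderiv ℝ ω y u :=
    (hω.continuous_fderiv one_ne_zero).clm_apply continuous_const
  simp only [← kernelOp_regField_fderiv (hε0 _) v u hω hωc]
  refine tendsto_integral_of_dominated_convergence
    (fun y => ‖regField 0 v (x - y) * fderiv ℝ ω y u‖) (fun n => ?_)
    (integrable_regField_zero_mul hv c2 (hωc.fderiv_apply ℝ u) x).norm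
    (fun n => Eventually.of_forall fun y => ?_) (Eventually.of_forall fun y => ?_)
  · exact (((continuous_regField (hε0 n) v).comp (by fun_prop)).mul c2).aestronglyMeasurable
  · rw [norm_mul, norm_mul]
    gcongr
    exact abs_regField_le_abs_regField_zero _ _ _
  · exact (tendsto_regField v _ hε).mul_const _

theorem biotSavart_eq {ω : Plane → ℝ} (hω : Continuous ω) (hωc : HasCompactSupport ω)
    (x : Plane) :
    biotSavart ω x = (1 / (2 * Real.pi)) •
      (kernelOp (regField 0 (planeBasis 0)) ω x • planeBasis 1
        - kernelOp (regField 0 (planeBasis 1)) ω x • planeBasis 0) := by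
  rw [biotSavart, kernelOp, kernelOp, ← integral_smul_const, ← integral_smul_const,
    ← integral_sub ((integrable_regField_zero_mul (norm_planeBasis 0) hω hωc x).smul_const _)
      ((integrable_regField_zero_mul (norm_planeBasis 1) hω hωc x).smul_const _)]
  congr 1
  refine integral_congr_ae (Eventually.of_forall fun y => ?_)
  ext i
  simp only [regField, inner_planeBasis]
  fin_cases i <;> simp [perp, planeBasis] <;> ring

theorem norm_le_abs_add_abs (L : Plane →L[ℝ] ℝ) :
    ‖L‖ ≤ |L (planeBasis 0)| + |L (planeBasis 1)| := by
  refine L.opNorm_le_bound (by positivity) fun z => ?_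
  have hz : z = z 0 • planeBasis 0 + z 1 • planeBasis 1 := by
    ext i
    fin_cases i <;> simp [planeBasis]
  have h : ∀ i, |z i| ≤ ‖z‖ := fun i => PiLp.norm_apply_le z i
  have hL : L z = z 0 * L (planeBasis 0) + z 1 * L (planeBasis 1) := by
    conv_lhs => rw [hz]
    simp
  rw [hL, Real.norm_eq_abs]
  refine (abs_add_le _ _).trans ?_
  rw [abs_mul, abs_mul]
  nlinarith [mul_le_mul_of_nonneg_right (h 0) (abs_nonneg (L (planeBasis 0))),
    mul_le_mul_of_nonneg_right (h 1) (abs_nonneg (L (planeBasis 1)))]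

theorem norm_fderiv_biotSavart_le {ω : Plane → ℝ} (hω : ContDiff ℝ 1 ω)
    (hωc : HasCompactSupport ω) (x : Plane) :
    ‖fderiv ℝ (biotSavart ω) x‖ ≤ ∑ q : Fin 2 × Fin 2,
      |kernelOp (regField 0 (planeBasis q.1)) (fun y => fderiv ℝ ω y (planeBasis q.2)) x| := by
  obtain ⟨L₀, h₀, e₀⟩ := hasFDerivAt_kernelOp_regField_zero (norm_planeBasis 0) hω hωc x
  obtain ⟨L₁, h₁, e₁⟩ := hasFDerivAt_kernelOp_regField_zero (norm_planeBasis 1) hω hωc x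
  have h := ((h₀.smul_const (planeBasis 1)).sub (h₁.smul_const (planeBasis 0))).const_smul
    (1 / (2 * Real.pi))
  have hb : biotSavart ω = fun x => (1 / (2 * Real.pi)) •
      (kernelOp (regField 0 (planeBasis 0)) ω x • planeBasis 1
        - kernelOp (regField 0 (planeBasis 1)) ω x • planeBasis 0) :=
    funext (biotSavart_eq hω.continuous hωc)
  have hpi : 1 / (2 * Real.pi) ≤ 1 := by
    rw [div_le_one (by positivity)]
    linarith [Real.pi_gt_three]
  have hd : fderiv ℝ (biotSavart ω) x = (1 / (2 * Real.pi)) •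
      (L₀.smulRight (planeBasis 1) - L₁.smulRight (planeBasis 0)) := by
    rw [hb]
    exact h.fderiv
  rw [hd, norm_smul, Real.norm_of_nonneg (by positivity)]
  refine (mul_le_of_le_one_left (norm_nonneg _) hpi).trans ((norm_sub_le _ _).trans ?_)
  rw [ContinuousLinearMap.norm_smulRight_apply, ContinuousLinearMap.norm_smulRight_apply]
  have b₀ := (mul_le_of_le_one_right (norm_nonneg L₀) (norm_planeBasis 1)).trans
    (norm_le_abs_add_abs L₀)
  have b₁ := (mul_le_of_le_one_right (norm_nonneg L₁) (norm_planeBasis 0)).trans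
    (norm_le_abs_add_abs L₁)
  refine le_of_le_of_eq (add_le_add b₀ b₁) ?_
  simp only [Fintype.sum_prod_type, Fin.sum_univ_two, e₀, e₁]

theorem exists_eLpNorm_kernelOp_fderiv_le {p : ℝ≥0∞} (hp : 1 < p) (hpt : p ≠ ⊤) :
    ∃ C : NNReal, ∀ ω : Plane → ℝ, ContDiff ℝ 1 ω → HasCompactSupport ω →
      ∀ M : ℝ, 0 < M → (∀ x, |ω x| ≤ M) → ∀ i j : Fin 2,
      AEStronglyMeasurable
        (kernelOp (regField 0 (planeBasis i)) fun y => fderiv ℝ ω y (planeBasis j)) ∧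
      eLpNorm (kernelOp (regField 0 (planeBasis i)) fun y => fderiv ℝ ω y (planeBasis j)) p
        ≤ C * (eLpNorm ω 1 + ENNReal.ofReal M) := by
  obtain ⟨A, H, hAH⟩ := exists_isCalderonZygmundKernel_regKernel
  obtain ⟨C, hC⟩ := IsCalderonZygmundKernel.exists_eLpNorm_le A H hp hpt
  refine ⟨C, fun ω hω hωc M hM hωM i j => ?_⟩
  have hi : Integrable ω := hω.continuous.integrable_of_hasCompactSupport hωc
  have hε0 : ∀ n : ℕ, 0 < 1 / ((n : ℝ) + 1) := fun n => by positivity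
  have hm : ∀ n : ℕ, AEStronglyMeasurable
      (kernelOp (regKernel (1 / ((n : ℝ) + 1)) (planeBasis i) (planeBasis j)) ω) := fun n =>
    ((hAH _ (hε0 n) i j).continuous_kernelOp hi).aestronglyMeasurable
  have ht := fun x => tendsto_kernelOp_regKernel (norm_planeBasis i) (planeBasis j) hω hωc x
    tendsto_one_div_add_atTop_nhds_zero_nat hε0
  refine ⟨aestronglyMeasurable_of_tendsto_ae atTop hm (Eventually.of_forall ht),
    (Lp.eLpNorm_lim_le_liminf_eLpNorm hm _ (Eventually.of_forall ht)).trans ?_⟩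
  refine liminf_le_of_frequently_le' (Eventually.of_forall fun n => ?_).frequently
  exact hC _ (hAH _ (hε0 n) i j) ω hω.continuous hi M hM hωM

end Gradient

end

/-- For every `p ∈ (1, ∞)` there is `C(p) > 0` such that for
every `C¹`, compactly supported `ω : ℝ² → ℝ`,
`‖∇𝕌(ω)‖_{L^p(ℝ²)} ≤ C(p) (‖ω‖_{L¹} + ‖ω‖_{L∞})`. -/
theorem biotSavart_gradient_Lp_bound :
    ∀ p : ℝ≥0∞, 1 < p → p ≠ ⊤ →
      ∃ C : ℝ, 0 < C ∧
        ∀ ω : EuclideanSpace ℝ (Fin 2) → ℝ,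
          ContDiff ℝ 1 ω → HasCompactSupport ω →
          eLpNorm (fun x => ‖fderiv ℝ (biotSavart ω) x‖) p volume ≤
            ENNReal.ofReal
              (C * ((eLpNorm ω 1 volume).toReal + (eLpNorm ω ⊤ volume).toReal)) := by
  intro p hp hpt
  obtain ⟨C, hC⟩ := exists_eLpNorm_kernelOp_fderiv_le hp hpt
  refine ⟨4 * C + 1, by positivity, fun ω hω hωc => ?_⟩
  have h1 : eLpNorm ω 1 volume ≠ ⊤ :=
    (hω.continuous.memLp_of_hasCompactSupport hωc).eLpNorm_ne_top
  have hT : eLpNorm ω ⊤ volume ≠ ⊤ :=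
    (hω.continuous.memLp_of_hasCompactSupport hωc).eLpNorm_ne_top
  have hM : ∀ x, |ω x| ≤ (eLpNorm ω ⊤ volume).toReal := by
    have hae : ∀ᵐ x, |ω x| ≤ (eLpNorm ω ⊤ volume).toReal := by
      filter_upwards [ae_le_eLpNormEssSup (f := ω) (μ := volume)] with x hx
      rw [← eLpNorm_exponent_top] at hx
      simpa using ENNReal.toReal_mono hT hx
    have hcl : IsClosed {x | |ω x| ≤ (eLpNorm ω ⊤ volume).toReal} :=
      isClosed_le hω.continuous.abs continuous_const
    have hd := (Measure.dense_of_ae hae).closure_eq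
    rw [hcl.closure_eq] at hd
    exact fun x => hd.ge (Set.mem_univ x)
  rcases (ENNReal.toReal_nonneg (a := eLpNorm ω ⊤ volume)).eq_or_lt with h0 | h0
  · have hω0 : ω = 0 := funext fun x => abs_nonpos_iff.1 ((hM x).trans_eq h0.symm)
    have : biotSavart ω = fun _ => 0 := funext fun x => by simp [biotSavart, hω0]
    simp [this]
  have hb := hC ω hω hωc _ h0 hM
  rw [ENNReal.ofReal_toReal hT] at hb
  calc eLpNorm (fun x => ‖fderiv ℝ (biotSavart ω) x‖) p volume
      ≤ eLpNorm (∑ q : Fin 2 × Fin 2, fun x => |kernelOp (regField 0 (planeBasis q.1))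
          (fun y => fderiv ℝ ω y (planeBasis q.2)) x|) p volume := by
        refine eLpNorm_mono_real fun x => ?_
        rw [norm_norm, Finset.sum_apply]
        exact norm_fderiv_biotSavart_le hω hωc x
    _ ≤ ∑ q : Fin 2 × Fin 2, eLpNorm (fun x => |kernelOp (regField 0 (planeBasis q.1))
          (fun y => fderiv ℝ ω y (planeBasis q.2)) x|) p volume :=
        eLpNorm_sum_le (fun q _ => (hb q.1 q.2).1.norm) hp.le
    _ ≤ ∑ _q : Fin 2 × Fin 2, C * (eLpNorm ω 1 volume + eLpNorm ω ⊤ volume) := by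
        refine Finset.sum_le_sum fun q _ => ?_
        simp only [← Real.norm_eq_abs]
        rw [eLpNorm_norm]
        exact (hb q.1 q.2).2
    _ = ENNReal.ofReal (4 * C * (
          (eLpNorm ω 1 volume).toReal + (eLpNorm ω ⊤ volume).toReal)) := by
        rw [ENNReal.ofReal_mul (by positivity), ENNReal.ofReal_add toReal_nonneg toReal_nonneg,
          ENNReal.ofReal_toReal h1, ENNReal.ofReal_toReal hT, ENNReal.ofReal_mul (by norm_num)]
        simp [mul_assoc]
    _ ≤ _ := by
        gcongr
        linarith

end
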